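/- arXiv:1403.6249 — 8 statements merged into one kernel-verified Lean document; each statement's English description precedes it below -/
import Mathlib

section
/- For every λ > 0 and every n ≥ 1, there exist real constants A_n and B_n such that the Sobolev–Legendre orthogonal polynomial S_n(·;λ) satisfies the differential relation λ S_n''(x;λ) − S_n(x;λ) = A_n P'_{n+1}(x) + B_n P'_{n−1}(x) for all x ∈ ℝ, where P_m denotes the Legendre polynomial of degree m. -/
open Polynomial MeasureTheory intervalIntegral

/-- Integration of a polynomial over `[-1, 1]`, as a linear functional. -/
noncomputable def symmIntegral : Polynomial ℝ →ₗ[ℝ] ℝ where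
  toFun p := ∫ x in (-1:ℝ)..1, p.eval x
  map_add' p q := by
    simp only [eval_add]
    exact integral_add (p.continuous.intervalIntegrable _ _) (q.continuous.intervalIntegrable _ _)
  map_smul' c p := by simp

theorem symmIntegral_apply (p : Polynomial ℝ) :
    symmIntegral p = ∫ x in (-1:ℝ)..1, p.eval x := rfl

theorem symmIntegral_C_mul (c : ℝ) (p : Polynomial ℝ) :
    symmIntegral (C c * p) = c * symmIntegral p := by
  rw [← smul_eq_C_mul, map_smul, smul_eq_mul]

theorem symmIntegral_derivative (p : Polynomial ℝ) :
    symmIntegral (derivative p) = p.eval 1 - p.eval (-1) :=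
  integral_eq_sub_of_hasDerivAt (fun x _ => p.hasDerivAt x)
    ((derivative p).continuous.intervalIntegrable _ _)

theorem symmIntegral_derivative_mul (p q : Polynomial ℝ) :
    symmIntegral (derivative p * q) =
      p.eval 1 * q.eval 1 - p.eval (-1) * q.eval (-1) - symmIntegral (p * derivative q) := by
  have h := symmIntegral_derivative (p * q)
  rw [derivative_mul, map_add, eval_mul, eval_mul] at h
  linarith

theorem symmIntegral_comp_neg (p : Polynomial ℝ) :
    symmIntegral (p.comp (-X)) = symmIntegral p := by
  simp only [symmIntegral_apply, eval_comp, eval_neg, eval_X]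
  rw [integral_comp_neg (fun x => p.eval x), neg_neg]

theorem symmIntegral_mul_self_nonneg (p : Polynomial ℝ) : 0 ≤ symmIntegral (p * p) := by
  rw [symmIntegral_apply]
  refine integral_nonneg (by norm_num) fun x _ => ?_
  rw [eval_mul]
  exact mul_self_nonneg _

theorem eq_zero_of_symmIntegral_mul_self (p : Polynomial ℝ) (h : symmIntegral (p * p) = 0) :
    p = 0 := by
  rw [symmIntegral_apply] at h
  by_contra hp
  obtain ⟨c, hc, hpc⟩ : ∃ c ∈ Set.Icc (-1:ℝ) 1, p.eval c ≠ 0 := by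
    by_contra! hall
    exact hp (p.eq_zero_of_infinite_isRoot
      ((Set.Icc_infinite (by norm_num : (-1:ℝ) < 1)).mono hall))
  refine (integral_pos (by norm_num : (-1:ℝ) < 1) (p * p).continuous.continuousOn
    (fun x _ => ?_) ⟨c, hc, ?_⟩).ne' h
  · rw [eval_mul]
    exact mul_self_nonneg _
  · rw [eval_mul]
    exact mul_self_pos.mpr hpc

theorem exists_degree_sub_C_mul_lt {p q : Polynomial ℝ} {k : ℕ} (hp : p.coeff k ≠ 0)
    (hp' : p.natDegree ≤ k) (hq : q.natDegree ≤ k) :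
    ∃ c : ℝ, (q - C c * p).degree < (k : WithBot ℕ) := by
  refine ⟨q.coeff k / p.coeff k, (degree_lt_iff_coeff_zero _ _).mpr fun m hm => ?_⟩
  rw [coeff_sub, coeff_C_mul]
  rcases hm.eq_or_lt with rfl | hm
  · field_simp
    simp
  · rw [coeff_eq_zero_of_natDegree_lt (hq.trans_lt hm),
      coeff_eq_zero_of_natDegree_lt (hp'.trans_lt hm)]
    simp

theorem coeff_ne_zero_of_natDegree_eq {p : Polynomial ℝ} {k : ℕ} (h : p.natDegree = k)
    (hp : p ≠ 0) : p.coeff k ≠ 0 := by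
  rw [← h]
  exact leadingCoeff_ne_zero.mpr hp

theorem comp_neg_X_coeff_eq (p : Polynomial ℝ) (m : ℕ) :
    (p.comp (-X)).coeff m = (-1) ^ m * p.coeff m := by
  have h : (-X : Polynomial ℝ) = C (-1) * X := by simp
  rw [h, comp_C_mul_X_coeff, mul_comm]

/-- A polynomial that is orthogonal to all polynomials of lower degree, for a Sobolev inner
product on `[-1, 1]`, has the parity of its degree. -/
theorem comp_neg_X_eq_of_sobolev_orthogonal {l : ℝ} (hl : 0 ≤ l) {p : Polynomial ℝ} {n : ℕ}
    (hp : p.natDegree ≤ n)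
    (horth : ∀ q : Polynomial ℝ, q.degree < (n : WithBot ℕ) →
      symmIntegral (p * q) + l * symmIntegral (derivative p * derivative q) = 0) :
    p.comp (-X) = C ((-1) ^ n) * p := by
  have hcomp : ∀ q : Polynomial ℝ, (q.comp (-X)).comp (-X) = q := comp_neg_X_comp_neg_X
  set d := p.comp (-X) - C ((-1) ^ n) * p with hd
  have hdn : d.degree < (n : WithBot ℕ) := by
    rw [degree_lt_iff_coeff_zero]
    intro m hm
    rw [hd, coeff_sub, coeff_C_mul, comp_neg_X_coeff_eq]
    rcases hm.eq_or_lt with rfl | hm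
    · ring
    · rw [coeff_eq_zero_of_natDegree_lt (hp.trans_lt hm)]
      ring
  have h1 := horth d hdn
  have h2 := horth _ (degree_comp_neg_X.trans_lt hdn)
  rw [← symmIntegral_comp_neg (p * _), ← symmIntegral_comp_neg (derivative p * _), mul_comp,
    mul_comp, hcomp, derivative_comp, mul_comp, hcomp] at h2
  have e1 : symmIntegral (d * d) =
      symmIntegral (p.comp (-X) * d) - (-1) ^ n * symmIntegral (p * d) := by
    rw [← symmIntegral_C_mul, ← map_sub]
    congr 1
    nth_rw 1 [hd]
    ring
  have e2 : symmIntegral (derivative d * derivative d) =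
      symmIntegral ((derivative p).comp (-X) * ((derivative (-X : Polynomial ℝ)).comp (-X) *
        derivative d)) - (-1) ^ n * symmIntegral (derivative p * derivative d) := by
    rw [← symmIntegral_C_mul, ← map_sub]
    congr 1
    nth_rw 1 [hd]
    rw [derivative_sub, derivative_C_mul, derivative_comp]
    simp
    ring
  have hsum : symmIntegral (d * d) + l * symmIntegral (derivative d * derivative d) = 0 := by
    rw [e1, e2]
    linear_combination h2 - (-1) ^ n * h1
  have := mul_nonneg hl (symmIntegral_mul_self_nonneg (derivative d))
  have := symmIntegral_mul_self_nonneg d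
  exact sub_eq_zero.mp (eq_zero_of_symmIntegral_mul_self d (by linarith))

/-- In an orthogonal sequence of polynomials of degrees `0, 1, 2, …`, each term is orthogonal to
all polynomials of lower degree. -/
theorem symmIntegral_mul_eq_zero_of_degree_lt {P : ℕ → Polynomial ℝ}
    (hdeg : ∀ m, (P m).natDegree = m) (hne : ∀ m, P m ≠ 0)
    (horth : ∀ m k, m ≠ k → symmIntegral (P m * P k) = 0) {m k : ℕ} (hk : k ≤ m) :
    ∀ q : Polynomial ℝ, q.degree < (k : WithBot ℕ) → symmIntegral (P m * q) = 0 := by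
  induction k with
  | zero =>
    intro q hq
    have : q = 0 := by
      ext i
      exact (degree_lt_iff_coeff_zero q 0).mp hq i i.zero_le
    simp [this]
  | succ k ih =>
    intro q hq
    have hqk : q.natDegree ≤ k := natDegree_le_iff_coeff_eq_zero.mpr fun i hi =>
      (degree_lt_iff_coeff_zero q (k + 1)).mp hq i hi
    obtain ⟨c, hc⟩ := exists_degree_sub_C_mul_lt
      (coeff_ne_zero_of_natDegree_eq (hdeg k) (hne k)) (hdeg k).le hqk
    have h := ih (by omega) _ hc
    rw [mul_sub, map_sub, mul_left_comm, symmIntegral_C_mul, horth m k (by omega)] at h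
    linarith

/-- For every λ > 0 and every n ≥ 1, there exist real constants A_n and B_n such
that the Sobolev–Legendre orthogonal polynomial S_n(·;λ) satisfies
λ S_n''(x;λ) − S_n(x;λ) = A_n P'_{n+1}(x) + B_n P'_{n−1}(x) for all x ∈ ℝ,
where P_m is the Legendre polynomial of degree m. -/
theorem sobolev_legendre_differential_relation
    -- P : the Legendre polynomials
    (P : ℕ → Polynomial ℝ)
    (hPdeg : ∀ m, (P m).natDegree = m)
    (hPorth : ∀ m k, m ≠ k → ∫ x in (-1:ℝ)..1, (P m).eval x * (P k).eval x = 0)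
    (hPone : ∀ m, (P m).eval 1 = 1)
    -- the Sobolev parameter
    (lam : ℝ) (hlam : 0 < lam)
    -- S : the Sobolev-Legendre orthogonal polynomials for ⟨f,g⟩_S = ∫ f g + λ ∫ f' g'
    (S : ℕ → Polynomial ℝ)
    (hSdeg : ∀ m, (S m).natDegree = m)
    (hSorth : ∀ m : ℕ, ∀ q : Polynomial ℝ, q.degree < (m : WithBot ℕ) →
      (∫ x in (-1:ℝ)..1, (S m).eval x * q.eval x)
        + lam * ∫ x in (-1:ℝ)..1, (derivative (S m)).eval x * (derivative q).eval x = 0)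
    (hSone : ∀ m, (S m).eval 1 = 1)
    (n : ℕ) (hn : 1 ≤ n) :
    ∃ A B : ℝ, ∀ x : ℝ,
      lam * (derivative (derivative (S n))).eval x - (S n).eval x
        = A * (derivative (P (n + 1))).eval x + B * (derivative (P (n - 1))).eval x := by
  have hPne : ∀ m, P m ≠ 0 := fun m h => by simpa [h] using hPone m
  have hPlow : ∀ m : ℕ, ∀ q : Polynomial ℝ, q.degree < (m : WithBot ℕ) →
      symmIntegral (P m * q) = 0 := fun m =>
    symmIntegral_mul_eq_zero_of_degree_lt hPdeg hPne
      (fun i k hik => by simpa [symmIntegral_apply] using hPorth i k hik) le_rfl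
  have hPneg : ∀ m, (P m).eval (-1) = (-1) ^ m := fun m => by
    have h := congrArg (eval 1) (comp_neg_X_eq_of_sobolev_orthogonal le_rfl (hPdeg m).le
      fun q hq => by rw [hPlow m q hq, zero_mul, add_zero])
    simpa [hPone] using h
  have hPder : ∀ m : ℕ, ∀ q : Polynomial ℝ, (derivative q).degree < (m : WithBot ℕ) →
      symmIntegral (derivative (P m) * q) = q.eval 1 - (-1) ^ m * q.eval (-1) := fun m q hq => by
    rw [symmIntegral_derivative_mul, hPlow m _ hq, hPone, hPneg]
    ring
  have hSlow : ∀ q : Polynomial ℝ, q.degree < (n : WithBot ℕ) →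
      symmIntegral (S n * q) + lam * symmIntegral (derivative (S n) * derivative q) = 0 :=
    fun q hq => by simpa [symmIntegral_apply] using hSorth n q hq
  have hSneg : (derivative (S n)).eval (-1) = (-1) ^ (n + 1) * (derivative (S n)).eval 1 := by
    have h := congrArg (fun p => (derivative p).eval 1)
      (comp_neg_X_eq_of_sobolev_orthogonal hlam.le (hSdeg n).le hSlow)
    simp [derivative_comp, -map_pow, -map_neg] at h
    rw [pow_succ]
    linarith
  obtain ⟨m, rfl⟩ : ∃ m, n = m + 1 := ⟨n - 1, by omega⟩
  simp only [Nat.add_sub_cancel]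
  set R := C lam * derivative (derivative (S (m + 1))) - S (m + 1) with hR
  have hRdeg : R.natDegree ≤ m + 1 := by
    refine (natDegree_sub_le _ _).trans (max_le ((natDegree_C_mul_le _ _).trans ?_) (hSdeg _).le)
    have h1 := natDegree_derivative_le (derivative (S (m + 1)))
    have h2 := natDegree_derivative_le (S (m + 1))
    rw [hSdeg] at h2
    omega
  have hcoeff : (derivative (P (m + 1 + 1))).coeff (m + 1) ≠ 0 := by
    rw [coeff_derivative]
    exact mul_ne_zero (coeff_ne_zero_of_natDegree_eq (hPdeg _) (hPne _)) (by positivity)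
  have hder : ∀ k, (derivative (P k)).natDegree ≤ k - 1 := fun k =>
    (natDegree_derivative_le (P k)).trans_eq (by rw [hPdeg])
  obtain ⟨A, hA⟩ := exists_degree_sub_C_mul_lt hcoeff (hder _) hRdeg
  set B := lam * (derivative (S (m + 1))).eval 1 - A with hB
  set T := R - C A * derivative (P (m + 1 + 1)) - C B * derivative (P m) with hT
  have hTdeg : T.degree < ((m + 1 : ℕ) : WithBot ℕ) := by
    rw [degree_lt_iff_coeff_zero] at hA ⊢
    intro i hi
    rw [hT, coeff_sub, hA i hi, coeff_C_mul,
      coeff_eq_zero_of_natDegree_lt ((hder m).trans_lt (by omega)), mul_zero, sub_zero]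
  have hT' : ∀ i, m ≤ i → (derivative T).coeff i = 0 := fun i hi => by
    rw [coeff_derivative, (degree_lt_iff_coeff_zero _ _).mp hTdeg (i + 1) (by omega), zero_mul]
  have hTT : symmIntegral (T * T) = 0 := by
    have e : T * T = C lam * (derivative (derivative (S (m + 1))) * T) - S (m + 1) * T
        - C A * (derivative (P (m + 1 + 1)) * T) - C B * (derivative (P m) * T) := by
      nth_rw 1 [hT]
      rw [hR]
      ring
    rw [e, map_sub, map_sub, map_sub, symmIntegral_C_mul, symmIntegral_C_mul, symmIntegral_C_mul,
      symmIntegral_derivative_mul (derivative (S (m + 1))),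
      hPder _ T ((degree_lt_iff_coeff_zero _ _).mpr fun i hi => hT' i (by omega)),
      hPder _ T ((degree_lt_iff_coeff_zero _ _).mpr hT'), hSneg]
    linear_combination -hSlow T hTdeg +
      (-(eval 1 T) + (-1) ^ m * eval (-1) T) * hB
  refine ⟨A, B, fun x => ?_⟩
  have h := congrArg (eval x) (eq_zero_of_symmIntegral_mul_self T hTT)
  simp only [hT, hR, eval_sub, eval_mul, eval_C, eval_zero] at h
  linarith
end

section
/- For every λ > 0 and every n ≥ 2, there exists a real constant a_n such that S_n(x;λ) − S_{n−2}(x;λ) = a_n (P_n(x) − P_{n−2}(x)) for all x ∈ ℝ. -/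
open Polynomial MeasureTheory intervalIntegral

/-- Integration over `[-1, 1]` as a linear functional on polynomials. -/
noncomputable def legendreIntegral : ℝ[X] →ₗ[ℝ] ℝ where
  toFun p := ∫ x in (-1 : ℝ)..1, p.eval x
  map_add' p q := by
    simp only [eval_add]
    exact integral_add (p.continuous.intervalIntegrable _ _) (q.continuous.intervalIntegrable _ _)
  map_smul' c p := by
    simp [eval_smul]

theorem legendreIntegral_apply (p : ℝ[X]) :
    legendreIntegral p = ∫ x in (-1 : ℝ)..1, p.eval x := rfl

theorem legendreIntegral_derivative (p : ℝ[X]) :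
    legendreIntegral (derivative p) = p.eval 1 - p.eval (-1) := by
  rw [legendreIntegral_apply]
  exact integral_eq_sub_of_hasDerivAt (fun x _ => p.hasDerivAt x)
    ((derivative p).continuous.intervalIntegrable _ _)

theorem legendreIntegral_comp_neg_X (p : ℝ[X]) :
    legendreIntegral (p.comp (-X)) = legendreIntegral p := by
  simp only [legendreIntegral_apply, eval_comp, eval_neg, eval_X]
  rw [integral_comp_neg (fun x => p.eval x), neg_neg]

theorem legendreIntegral_mul_self_nonneg (p : ℝ[X]) : 0 ≤ legendreIntegral (p * p) := by
  rw [legendreIntegral_apply]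
  refine integral_nonneg (by norm_num) fun x _ => ?_
  rw [eval_mul]
  exact mul_self_nonneg _

theorem eq_zero_of_legendreIntegral_mul_self {p : ℝ[X]} (h : legendreIntegral (p * p) = 0) :
    p = 0 := by
  refine eq_zero_of_infinite_isRoot p ((Set.Icc_infinite (show (-1 : ℝ) < 1 by norm_num)).mono ?_)
  intro c hc
  by_contra hpc
  refine absurd h (ne_of_gt ?_)
  rw [legendreIntegral_apply]
  refine integral_pos (by norm_num) (p * p).continuous.continuousOn (fun x _ => ?_) ⟨c, hc, ?_⟩
  · rw [eval_mul]
    exact mul_self_nonneg _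
  · rw [eval_mul]
    exact mul_self_pos.mpr hpc

theorem degree_lt_of_natDegree_eq {Q : ℝ[X]} {m k : ℕ} (h : Q.natDegree = m) (hmk : m < k) :
    Q.degree < (k : WithBot ℕ) :=
  degree_le_natDegree.trans_lt (by rw [h]; exact_mod_cast hmk)

/-- A polynomial of degree at most `k` is, up to lower degree, a multiple of any given nonzero
polynomial of degree `k`. -/
theorem exists_eq_C_mul_add_of_degree_lt {Q : ℝ[X]} {k : ℕ} (hQ : Q.natDegree = k) (hQ0 : Q ≠ 0)
    {p : ℝ[X]} (hp : p.degree < ((k + 1 : ℕ) : WithBot ℕ)) :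
    ∃ (c : ℝ) (r : ℝ[X]), r.degree < (k : WithBot ℕ) ∧ p = C c * Q + r := by
  have hc : Q.coeff k ≠ 0 := by
    rw [← hQ]
    exact leadingCoeff_ne_zero.mpr hQ0
  refine ⟨p.coeff k / Q.coeff k, p - C (p.coeff k / Q.coeff k) * Q, ?_, by ring⟩
  rw [degree_lt_iff_coeff_zero] at hp ⊢
  intro m hm
  rw [coeff_sub, coeff_C_mul]
  rcases hm.eq_or_lt with rfl | hm
  · field_simp
    ring
  · rw [hp m hm, coeff_eq_zero_of_natDegree_lt (hQ.trans_lt hm)]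
    ring

/-- Pairwise orthogonal polynomials of degrees `0, 1, 2, …` are orthogonal to all polynomials of
lower degree. -/
theorem legendreIntegral_mul_eq_zero_of_degree_lt {P : ℕ → ℝ[X]} (hdeg : ∀ m, (P m).natDegree = m)
    (h0 : ∀ m, P m ≠ 0) (horth : ∀ m k, m ≠ k → legendreIntegral (P m * P k) = 0) (m : ℕ) :
    ∀ k ≤ m, ∀ q : ℝ[X], q.degree < (k : WithBot ℕ) → legendreIntegral (P m * q) = 0 := by
  intro k
  induction k with
  | zero =>
    intro _ q hq
    rw [degree_lt_iff_coeff_zero] at hq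
    have : q = 0 := by
      ext i
      simpa using hq i (Nat.zero_le i)
    simp [this]
  | succ k ih =>
    intro hk q hq
    obtain ⟨c, r, hr, rfl⟩ := exists_eq_C_mul_add_of_degree_lt (hdeg k) (h0 k) hq
    rw [mul_add, map_add, ih (by omega) r hr,
      show P m * (C c * P k) = c • (P m * P k) by rw [smul_eq_C_mul]; ring,
      map_smul, horth m k (by omega)]
    simp

theorem coeff_comp_neg_X (p : ℝ[X]) (i : ℕ) :
    (p.comp (-X)).coeff i = (-1) ^ i * p.coeff i := by
  rw [show (-X : ℝ[X]) = C (-1) * X by simp, comp_C_mul_X_coeff, mul_comm]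

/-- Symmetry of orthogonal polynomials, at the endpoint `-1`. -/
theorem eval_neg_one_of_sobolev_orthogonal {lam : ℝ} (hlam : 0 ≤ lam) {Q : ℝ[X]} {m : ℕ}
    (hdeg : Q.natDegree = m) (hone : Q.eval 1 = 1)
    (horth : ∀ q : ℝ[X], q.degree < (m : WithBot ℕ) →
      legendreIntegral (Q * q) + lam * legendreIntegral (derivative Q * derivative q) = 0) :
    Q.eval (-1) = (-1) ^ m := by
  have hder (q : ℝ[X]) : derivative (q.comp (-X)) = -(derivative q).comp (-X) := by
    simp [derivative_comp]
  have hdegcomp {q : ℝ[X]} (hq : q.degree < (m : WithBot ℕ)) :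
      (q.comp (-X)).degree < (m : WithBot ℕ) := by
    rwa [degree_comp_neg_X]
  have hmove (p q : ℝ[X]) :
      legendreIntegral (p.comp (-X) * q) = legendreIntegral (p * q.comp (-X)) := by
    rw [← legendreIntegral_comp_neg_X, mul_comp, comp_neg_X_comp_neg_X]
  have horth' (q : ℝ[X]) (hq : q.degree < (m : WithBot ℕ)) :
      legendreIntegral (Q.comp (-X) * q)
        + lam * legendreIntegral (derivative (Q.comp (-X)) * derivative q) = 0 := by
    have h := horth _ (hdegcomp hq)
    rw [hder] at h ⊢
    rw [hmove, neg_mul, map_neg, hmove, ← map_neg, ← mul_neg]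
    exact h
  set R : ℝ[X] := Q.comp (-X) - C ((-1) ^ m) * Q with hR
  have hRdeg : R.degree < (m : WithBot ℕ) := by
    rw [degree_lt_iff_coeff_zero]
    intro i hi
    rw [hR, coeff_sub, coeff_comp_neg_X, coeff_C_mul]
    rcases hi.eq_or_lt with rfl | hi
    · ring
    · rw [coeff_eq_zero_of_natDegree_lt (hdeg.trans_lt hi)]
      ring
  have hRR : legendreIntegral (R * R)
      + lam * legendreIntegral (derivative R * derivative R) = 0 := by
    have e1 : R * R = Q.comp (-X) * R - ((-1 : ℝ) ^ m) • (Q * R) := by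
      rw [smul_eq_C_mul]
      linear_combination R * hR
    have e2 : derivative R * derivative R = derivative (Q.comp (-X)) * derivative R
        - ((-1 : ℝ) ^ m) • (derivative Q * derivative R) := by
      have : derivative R = derivative (Q.comp (-X)) - C ((-1) ^ m) * derivative Q := by
        rw [hR, derivative_sub, derivative_C_mul]
      rw [smul_eq_C_mul]
      linear_combination derivative R * this
    rw [e1, e2, map_sub, map_sub, map_smul, map_smul, smul_eq_mul, smul_eq_mul]
    linear_combination horth' R hRdeg - (-1) ^ m * horth R hRdeg
  have hR0 : R = 0 := by
    refine eq_zero_of_legendreIntegral_mul_self ?_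
    have h1 := legendreIntegral_mul_self_nonneg R
    have h2 := mul_nonneg hlam (legendreIntegral_mul_self_nonneg (derivative R))
    linarith
  have h := congrArg (eval 1) (hR.symm.trans hR0)
  simp only [eval_sub, eval_comp, eval_neg, eval_X, eval_mul, eval_C, hone, eval_zero] at h
  linarith

theorem degree_derivative_derivative_lt {p : ℝ[X]} {N : ℕ}
    (hp : p.degree < ((N + 1 : ℕ) : WithBot ℕ)) :
    (derivative (derivative p)).degree < (N : WithBot ℕ) := by
  rw [degree_lt_iff_coeff_zero] at hp ⊢
  intro m hm
  rw [coeff_derivative, coeff_derivative, hp (m + 1 + 1) (by omega)]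
  simp

/-- Subtracting a multiple of the second derivative is a surjective operation on polynomials of
bounded degree. -/
theorem exists_sub_C_mul_derivative_derivative_eq (lam : ℝ) (N : ℕ) :
    ∀ p : ℝ[X], p.degree < (N : WithBot ℕ) →
      ∃ q : ℝ[X], q.degree < (N : WithBot ℕ) ∧ q - C lam * derivative (derivative q) = p := by
  induction N with
  | zero =>
    intro p hp
    have : p = 0 := by
      rw [degree_lt_iff_coeff_zero] at hp
      ext i
      simpa using hp i (Nat.zero_le i)
    exact ⟨0, by simp, by simp [this]⟩
  | succ N ih =>
    intro p hp
    have hd : (C lam * derivative (derivative p)).degree < (N : WithBot ℕ) := by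
      have h := degree_derivative_derivative_lt hp
      rw [degree_lt_iff_coeff_zero] at h ⊢
      intro i hi
      rw [coeff_C_mul, h i hi, mul_zero]
    obtain ⟨r, hr, hre⟩ := ih _ hd
    refine ⟨p + r, ?_, ?_⟩
    · refine (degree_add_le p r).trans_lt (max_lt hp (hr.trans ?_))
      exact_mod_cast N.lt_succ_self
    · simp only [derivative_add]
      linear_combination hre

/-- A polynomial vanishing at `±1` which is Sobolev orthogonal to all polynomials of degree `< N`
is orthogonal to them for the Lebesgue measure. -/
theorem legendreIntegral_mul_eq_zero_of_sobolev {lam : ℝ} {D : ℝ[X]} {N : ℕ}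
    (h1 : D.eval 1 = 0) (h2 : D.eval (-1) = 0)
    (horth : ∀ q : ℝ[X], q.degree < (N : WithBot ℕ) →
      legendreIntegral (D * q) + lam * legendreIntegral (derivative D * derivative q) = 0)
    {p : ℝ[X]} (hp : p.degree < (N : WithBot ℕ)) : legendreIntegral (D * p) = 0 := by
  obtain ⟨q, hq, rfl⟩ := exists_sub_C_mul_derivative_derivative_eq lam N p hp
  have hparts := legendreIntegral_derivative (D * derivative q)
  rw [derivative_mul, map_add, eval_mul, eval_mul, h1, h2] at hparts
  rw [show D * (q - C lam * derivative (derivative q))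
    = D * q - lam • (D * derivative (derivative q)) by rw [smul_eq_C_mul]; ring,
    map_sub, map_smul, smul_eq_mul]
  linear_combination horth q hq - lam * hparts


open Polynomial MeasureTheory intervalIntegral

/-- For every λ > 0 and every n ≥ 2, there exists a real constant a_n such that
S_n(x;λ) − S_{n−2}(x;λ) = a_n (P_n(x) − P_{n−2}(x)) for all x ∈ ℝ. -/
theorem sobolev_legendre_recursive_relation
    (P : ℕ → Polynomial ℝ)
    (hPdeg : ∀ m, (P m).natDegree = m)
    (hPorth : ∀ m k, m ≠ k → ∫ x in (-1:ℝ)..1, (P m).eval x * (P k).eval x = 0)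
    (hPone : ∀ m, (P m).eval 1 = 1)
    (lam : ℝ) (hlam : 0 < lam)
    (S : ℕ → Polynomial ℝ)
    (hSdeg : ∀ m, (S m).natDegree = m)
    (hSorth : ∀ m : ℕ, ∀ q : Polynomial ℝ, q.degree < (m : WithBot ℕ) →
      (∫ x in (-1:ℝ)..1, (S m).eval x * q.eval x)
        + lam * ∫ x in (-1:ℝ)..1, (derivative (S m)).eval x * (derivative q).eval x = 0)
    (hSone : ∀ m, (S m).eval 1 = 1)
    (n : ℕ) (hn : 2 ≤ n) :
    ∃ a : ℝ, ∀ x : ℝ,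
      (S n).eval x - (S (n - 2)).eval x = a * ((P n).eval x - (P (n - 2)).eval x) := by
  obtain ⟨k, rfl⟩ : ∃ k, n = k + 2 := ⟨n - 2, by omega⟩
  rw [Nat.add_sub_cancel]
  have hP0 (m : ℕ) : P m ≠ 0 := fun h => by simpa [h] using hPone m
  have hPlow (m : ℕ) (q : ℝ[X]) (hq : q.degree < (m : WithBot ℕ)) :
      legendreIntegral (P m * q) = 0 := by
    refine legendreIntegral_mul_eq_zero_of_degree_lt hPdeg hP0 (fun i j hij => ?_) m m le_rfl q hq
    simpa only [legendreIntegral_apply, eval_mul] using hPorth i j hij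
  have hPneg (m : ℕ) : (P m).eval (-1) = (-1) ^ m :=
    eval_neg_one_of_sobolev_orthogonal (le_refl 0) (hPdeg m) (hPone m)
      fun q hq => by rw [hPlow m q hq]; simp
  have hS (m : ℕ) (q : ℝ[X]) (hq : q.degree < (m : WithBot ℕ)) :
      legendreIntegral (S m * q)
        + lam * legendreIntegral (derivative (S m) * derivative q) = 0 := by
    simpa only [legendreIntegral_apply, eval_mul] using hSorth m q hq
  have hSneg (m : ℕ) : (S m).eval (-1) = (-1) ^ m :=
    eval_neg_one_of_sobolev_orthogonal hlam.le (hSdeg m) (hSone m) (hS m)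
  set D : ℝ[X] := S (k + 2) - S k with hD
  have hD1 : D.eval 1 = 0 := by rw [hD, eval_sub, hSone, hSone, sub_self]
  have hD2 : D.eval (-1) = 0 := by
    rw [hD, eval_sub, hSneg, hSneg]
    ring
  have hDlow (q : ℝ[X]) (hq : q.degree < (k : WithBot ℕ)) : legendreIntegral (D * q) = 0 := by
    refine legendreIntegral_mul_eq_zero_of_sobolev (lam := lam) hD1 hD2 (fun q hq => ?_) hq
    have hq' : q.degree < ((k + 2 : ℕ) : WithBot ℕ) :=
      hq.trans (by exact_mod_cast (by omega : k < k + 2))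
    rw [hD, derivative_sub, sub_mul, sub_mul, map_sub, map_sub]
    linear_combination hS (k + 2) q hq' - hS k q hq
  have hDdeg : D.degree < ((k + 2 + 1 : ℕ) : WithBot ℕ) :=
    (degree_sub_le _ _).trans_lt (max_lt (degree_lt_of_natDegree_eq (hSdeg _) (by omega))
      (degree_lt_of_natDegree_eq (hSdeg _) (by omega)))
  obtain ⟨a, r, hr, hDr⟩ := exists_eq_C_mul_add_of_degree_lt (hPdeg (k + 2)) (hP0 _) hDdeg
  obtain ⟨b, s, hs, hrs⟩ := exists_eq_C_mul_add_of_degree_lt (hPdeg (k + 1)) (hP0 _) hr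
  obtain ⟨c, t, ht, hst⟩ := exists_eq_C_mul_add_of_degree_lt (hPdeg k) (hP0 _) hs
  have hDt : D = C a * P (k + 2) + C b * P (k + 1) + C c * P k + t := by
    rw [hDr, hrs, hst]
    ring
  have ht0 : t = 0 := by
    refine eq_zero_of_legendreIntegral_mul_self ?_
    have e : t * t = D * t - a • (P (k + 2) * t) - b • (P (k + 1) * t) - c • (P k * t) := by
      simp only [smul_eq_C_mul]
      linear_combination -t * hDt
    rw [e, map_sub, map_sub, map_sub, map_smul, map_smul, map_smul, hDlow t ht, hPlow k t ht,
      hPlow (k + 1) t (ht.trans (by exact_mod_cast (by omega : k < k + 1))),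
      hPlow (k + 2) t (ht.trans (by exact_mod_cast (by omega : k < k + 2)))]
    simp
  have hDe (x : ℝ) : D.eval x
      = a * (P (k + 2)).eval x + b * (P (k + 1)).eval x + c * (P k).eval x := by
    rw [hDt, ht0]
    simp
  have h1 := hDe 1
  have h2 := hDe (-1)
  rw [hD1, hPone, hPone, hPone] at h1
  rw [hD2, hPneg, hPneg, hPneg] at h2
  have h3 : a - b + c = 0 := by
    have hk : ((-1 : ℝ) ^ k) ≠ 0 := by simp
    refine mul_left_cancel₀ hk ?_
    linear_combination -h2
  refine ⟨a, fun x => ?_⟩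
  rw [← eval_sub, ← hD, hDe x]
  have hb : b = 0 := by linarith
  have hc : c = -a := by linarith
  rw [hb, hc]
  ring
end

section
/- For every λ > 0 and every n ≥ 1, the Sobolev–Legendre orthogonal polynomial S_n(·;λ) has exactly n real simple zeros, all of which lie in the open interval (−1,1). -/
open Polynomial MeasureTheory intervalIntegral

/-- A nonzero real polynomial `p` has a set of distinct roots in `(a, b)` (those of odd
multiplicity) such that `p` times the corresponding monic polynomial does not change sign
on `[a, b]`. -/
lemma exists_finset_prod_dvd_and_mul_prod_constant_sign {a b : ℝ} (p : ℝ[X]) (hp : p ≠ 0) :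
    ∃ s : Finset ℝ, (∀ z ∈ s, z ∈ Set.Ioo a b) ∧ (∏ z ∈ s, (X - C z)) ∣ p ∧
      ((∀ x ∈ Set.Icc a b, 0 ≤ p.eval x * (∏ z ∈ s, (X - C z)).eval x) ∨
        ∀ x ∈ Set.Icc a b, p.eval x * (∏ z ∈ s, (X - C z)).eval x ≤ 0) := by
  induction hd : p.natDegree generalizing p with
  | zero =>
    rw [natDegree_eq_zero] at hd
    obtain ⟨c, rfl⟩ := hd
    refine ⟨∅, by simp, by simp, ?_⟩
    rcases le_total 0 c with h | h
    · left; simp [h]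
    · right; simp [h]
  | succ d ih =>
    by_cases hroot : ∃ z ∈ Set.Ioo a b, p.IsRoot z
    · obtain ⟨z, hz, hpz⟩ := hroot
      obtain ⟨r, rfl⟩ := dvd_iff_isRoot.mpr hpz
      have hr : r ≠ 0 := right_ne_zero_of_mul hp
      have hrd : r.natDegree = d := by
        rw [natDegree_mul (X_sub_C_ne_zero z) hr, natDegree_X_sub_C] at hd
        omega
      obtain ⟨s, hs, hdvd, hsign⟩ := ih r hr hrd
      by_cases hzs : z ∈ s
      · refine ⟨s.erase z, fun w hw ↦ hs w (Finset.mem_of_mem_erase hw), ?_, ?_⟩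
        · exact (Finset.prod_dvd_prod_of_subset _ _ _ (s.erase_subset z)).trans
            (hdvd.trans (dvd_mul_left _ _))
        · have key (x : ℝ) : ((X - C z) * r).eval x * (∏ w ∈ s.erase z, (X - C w)).eval x
              = r.eval x * (∏ w ∈ s, (X - C w)).eval x := by
            rw [← Finset.mul_prod_erase s _ hzs]
            simp only [eval_mul]
            ring
          simpa only [key] using hsign
      · refine ⟨insert z s, fun w hw ↦ ?_, ?_, ?_⟩
        · rcases Finset.mem_insert.mp hw with rfl | h
          exacts [hz, hs w h]
        · rw [Finset.prod_insert hzs]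
          exact mul_dvd_mul_left _ hdvd
        · have key (x : ℝ) : ((X - C z) * r).eval x * (∏ w ∈ insert z s, (X - C w)).eval x
              = (x - z) ^ 2 * (r.eval x * (∏ w ∈ s, (X - C w)).eval x) := by
            rw [Finset.prod_insert hzs]
            simp only [eval_mul, eval_sub, eval_X, eval_C]
            ring
          simp only [key]
          exact hsign.imp (fun h x hx ↦ mul_nonneg (sq_nonneg _) (h x hx))
            (fun h x hx ↦ mul_nonpos_of_nonneg_of_nonpos (sq_nonneg _) (h x hx))
    · refine ⟨∅, by simp, by simp, ?_⟩
      simp only [Finset.prod_empty, eval_one, mul_one]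
      by_contra! hcon
      obtain ⟨⟨x, hx, hxneg⟩, y, hy, hypos⟩ := hcon
      obtain ⟨z, hz, hpz⟩ := intermediate_value_uIcc (p.continuous.continuousOn (s := Set.uIcc x y))
        (Set.mem_uIcc.mpr (Or.inl ⟨hxneg.le, hypos.le⟩))
      have hzx : z ≠ x := by rintro rfl; exact hxneg.ne hpz
      have hzy : z ≠ y := by rintro rfl; exact hypos.ne' hpz
      refine hroot ⟨z, ?_, hpz⟩
      rcases Set.mem_uIcc.mp hz with ⟨h₁, h₂⟩ | ⟨h₁, h₂⟩
      · exact ⟨hx.1.trans_lt (h₁.lt_of_ne hzx.symm), (h₂.lt_of_ne hzy).trans_le hy.2⟩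
      · exact ⟨hy.1.trans_lt (h₁.lt_of_ne hzy.symm), (h₂.lt_of_ne hzx).trans_le hx.2⟩

/-- If all points of `s` lie on one side of `c` (the side being given by `σ = ±1`), then the
derivatives of `∏ z ∈ s, (X - z)` at `c` have the expected signs. -/
lemma iterate_derivative_prod_X_sub_C_eval_sign {σ c : ℝ} (hσ : σ ^ 2 = 1) (s : Finset ℝ)
    (hs : ∀ z ∈ s, 0 ≤ σ * (c - z)) (k : ℕ) :
    0 ≤ σ ^ (s.card + k) * (derivative^[k] (∏ z ∈ s, (X - C z))).eval c := by
  rcases le_or_gt k s.card with hk | hk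
  · obtain ⟨m, hm⟩ := Nat.exists_eq_add_of_le' hk
    have hpow : σ ^ (s.card + k) = σ ^ m := by
      rw [hm, show m + k + k = m + 2 * k by ring, pow_add, pow_mul, hσ, one_pow, mul_one]
    rw [iterate_derivative_prod_X_sub_C hk, hpow, show s.card - k = m by omega]
    simp only [eval_mul, eval_natCast, eval_finsetSum, eval_prod, eval_sub, eval_X, eval_C]
    rw [mul_left_comm, Finset.mul_sum]
    refine mul_nonneg (Nat.cast_nonneg _) (Finset.sum_nonneg fun T hT ↦ ?_)
    obtain ⟨hTs, hTm⟩ := Finset.mem_powersetCard.mp hT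
    rw [← hTm, ← Finset.prod_const, ← Finset.prod_mul_distrib]
    exact Finset.prod_nonneg fun z hz ↦ hs z (hTs hz)
  · rw [iterate_derivative_eq_zero (by simpa using hk)]
    simp

/-- The polynomial `∑ i < N, lam ^ i * p⁽²ⁱ⁾`, which inverts `1 - lam * D²` on polynomials of
degree less than `2 * N`. -/
noncomputable def evenDerivativeSum (lam : ℝ) (N : ℕ) (p : ℝ[X]) : ℝ[X] :=
  ∑ i ∈ Finset.range N, C (lam ^ i) * derivative^[2 * i] p

lemma derivative_evenDerivativeSum (lam : ℝ) (N : ℕ) (p : ℝ[X]) :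
    derivative (evenDerivativeSum lam N p) =
      ∑ i ∈ Finset.range N, C (lam ^ i) * derivative^[2 * i + 1] p := by
  simp only [evenDerivativeSum, derivative_sum, derivative_C_mul, Function.iterate_succ_apply']

lemma evenDerivativeSum_sub (lam : ℝ) {N : ℕ} {p : ℝ[X]} (hN : p.natDegree < 2 * N) :
    evenDerivativeSum lam N p - C lam * derivative (derivative (evenDerivativeSum lam N p)) =
      p := by
  have h : C lam * derivative (derivative (evenDerivativeSum lam N p)) =
      ∑ i ∈ Finset.range N, C (lam ^ (i + 1)) * derivative^[2 * (i + 1)] p := by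
    rw [derivative_evenDerivativeSum, derivative_sum, Finset.mul_sum]
    refine Finset.sum_congr rfl fun i _ ↦ ?_
    rw [derivative_C_mul, ← Function.iterate_succ_apply' (⇑derivative), ← mul_assoc, ← C_mul,
      pow_succ']
    rfl
  rw [h, evenDerivativeSum, ← Finset.sum_sub_distrib,
    Finset.sum_range_sub' (fun i ↦ C (lam ^ i) * derivative^[2 * i] p) N,
    iterate_derivative_eq_zero hN]
  simp

lemma degree_evenDerivativeSum_lt {lam : ℝ} {N n : ℕ} {p : ℝ[X]}
    (hp : p.degree < (n : WithBot ℕ)) :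
    (evenDerivativeSum lam N p).degree < (n : WithBot ℕ) := by
  rw [← mem_degreeLT] at hp ⊢
  refine Submodule.sum_mem _ fun i _ ↦ ?_
  rw [← smul_eq_C_mul]
  refine Submodule.smul_mem _ _ ?_
  induction 2 * i with
  | zero => exact hp
  | succ k ih =>
    rw [Function.iterate_succ_apply', mem_degreeLT]
    exact degree_derivative_le.trans_lt (mem_degreeLT.mp ih)

lemma derivative_evenDerivativeSum_prod_eval_sign {lam σ c : ℝ} (hlam : 0 ≤ lam)
    (hσ : σ ^ 2 = 1) (s : Finset ℝ) (hs : ∀ z ∈ s, 0 ≤ σ * (c - z)) (N : ℕ) :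
    0 ≤ σ ^ (s.card + 1) *
      (derivative (evenDerivativeSum lam N (∏ z ∈ s, (X - C z)))).eval c := by
  rw [derivative_evenDerivativeSum, eval_finsetSum, Finset.mul_sum]
  refine Finset.sum_nonneg fun i _ ↦ ?_
  have h := iterate_derivative_prod_X_sub_C_eval_sign hσ s hs (2 * i + 1)
  rw [show s.card + (2 * i + 1) = s.card + 1 + 2 * i by ring, pow_add, pow_mul, hσ, one_pow,
    mul_one] at h
  rw [eval_mul, eval_C, mul_left_comm]
  exact mul_nonneg (pow_nonneg hlam i) h

lemma integral_derivative_mul_derivative (p q : ℝ[X]) (a b : ℝ) :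
    ∫ x in a..b, (derivative p).eval x * (derivative q).eval x =
      p.eval b * (derivative q).eval b - p.eval a * (derivative q).eval a
        - ∫ x in a..b, p.eval x * (derivative (derivative q)).eval x := by
  have h := integral_mul_deriv_eq_deriv_mul (a := a) (b := b)
    (fun x _ ↦ p.hasDerivAt x) (fun x _ ↦ (derivative q).hasDerivAt x)
    ((derivative p).continuous.intervalIntegrable a b)
    ((derivative (derivative q)).continuous.intervalIntegrable a b)
  linarith

/-- Integration by parts in the Sobolev inner product. -/
lemma sobolev_inner_eq (lam : ℝ) (p q : ℝ[X]) (a b : ℝ) :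
    (∫ x in a..b, p.eval x * q.eval x)
        + lam * ∫ x in a..b, (derivative p).eval x * (derivative q).eval x =
      (∫ x in a..b, p.eval x * (q - C lam * derivative (derivative q)).eval x)
        + lam * (p.eval b * (derivative q).eval b - p.eval a * (derivative q).eval a) := by
  have h : ∫ x in a..b, p.eval x * (q - C lam * derivative (derivative q)).eval x =
      (∫ x in a..b, p.eval x * q.eval x)
        - lam * ∫ x in a..b, p.eval x * (derivative (derivative q)).eval x := by
    rw [← intervalIntegral.integral_const_mul, ← intervalIntegral.integral_sub]
    · congr 1
      ext x
      simp only [eval_sub, eval_mul, eval_C]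
      ring
    · exact (p.continuous.mul q.continuous).intervalIntegrable a b
    · exact (continuous_const.mul
        (p.continuous.mul (derivative (derivative q)).continuous)).intervalIntegrable a b
  rw [h, integral_derivative_mul_derivative]
  ring

/-- If `p` has the sign pattern of `∏ z ∈ s, (X - z)` on `[-1, 1]` and is Sobolev-orthogonal to
all polynomials of degree less than `n`, then `s` has at least `n` elements. -/
lemma le_card_of_sobolev_orthogonal {lam : ℝ} (hlam : 0 < lam) {n : ℕ} {p : ℝ[X]}
    (horth : ∀ q : ℝ[X], q.degree < (n : WithBot ℕ) →
      (∫ x in (-1:ℝ)..1, p.eval x * q.eval x)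
        + lam * ∫ x in (-1:ℝ)..1, (derivative p).eval x * (derivative q).eval x = 0)
    (hone : 0 < p.eval 1) (s : Finset ℝ) (hs : ∀ z ∈ s, z ∈ Set.Ioo (-1 : ℝ) 1)
    (hsign : ∀ x ∈ Set.Icc (-1 : ℝ) 1, 0 ≤ p.eval x * (∏ z ∈ s, (X - C z)).eval x) :
    n ≤ s.card := by
  by_contra! hcard
  set π : ℝ[X] := ∏ z ∈ s, (X - C z) with hπ
  have hπdeg : π.natDegree = s.card := by simp [hπ]
  set q := evenDerivativeSum lam n π
  have hqdeg : q.degree < (n : WithBot ℕ) :=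
    degree_evenDerivativeSum_lt (degree_le_natDegree.trans_lt (by rw [hπdeg]; exact_mod_cast hcard))
  have h := horth q hqdeg
  rw [sobolev_inner_eq, evenDerivativeSum_sub lam (by omega)] at h
  have hπone : 0 < π.eval 1 := by
    rw [hπ, eval_prod]
    exact Finset.prod_pos fun z hz ↦ by simpa using (hs z hz).2
  have hint : 0 < ∫ x in (-1:ℝ)..1, p.eval x * π.eval x :=
    integral_pos (by norm_num) (p.continuous.mul π.continuous).continuousOn
      (fun x hx ↦ hsign x (Set.Ioc_subset_Icc_self hx)) ⟨1, by norm_num, mul_pos hone hπone⟩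
  have hright : 0 ≤ (derivative q).eval 1 := by
    simpa using derivative_evenDerivativeSum_prod_eval_sign (σ := 1) (c := 1) hlam.le (by norm_num)
      s (fun z hz ↦ by linarith [(hs z hz).2]) n
  have hleft : 0 ≤ (-1 : ℝ) ^ (s.card + 1) * (derivative q).eval (-1) :=
    derivative_evenDerivativeSum_prod_eval_sign (σ := -1) (c := -1) hlam.le (by norm_num)
      s (fun z hz ↦ by linarith [(hs z hz).1]) n
  have hπleft : 0 < (-1 : ℝ) ^ s.card * π.eval (-1) := by
    rw [hπ, eval_prod, ← Finset.prod_const, ← Finset.prod_mul_distrib]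
    refine Finset.prod_pos fun z hz ↦ ?_
    rw [eval_sub, eval_X, eval_C]
    linarith [(hs z hz).1]
  have hsq : ((-1 : ℝ) ^ s.card) * (-1) ^ s.card = 1 := by
    rw [← mul_pow]; norm_num
  have hpleft : 0 ≤ (-1 : ℝ) ^ s.card * p.eval (-1) := by
    refine nonneg_of_mul_nonneg_left ?_ hπleft
    have := hsign (-1) (by norm_num)
    linear_combination this - p.eval (-1) * π.eval (-1) * hsq
  have hboundary : p.eval (-1) * (derivative q).eval (-1) ≤ 0 := by
    have := mul_nonneg hpleft hleft
    rw [pow_succ] at this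
    linear_combination this - p.eval (-1) * (derivative q).eval (-1) * hsq
  have : 0 ≤ lam * (p.eval 1 * (derivative q).eval 1 - p.eval (-1) * (derivative q).eval (-1)) :=
    mul_nonneg hlam.le (by linarith [mul_nonneg hone.le hright])
  linarith

/-- For every λ > 0 and every n ≥ 1, the Sobolev–Legendre orthogonal polynomial
S_n(·;λ) has exactly n real simple zeros, all of which lie in the open interval (−1,1). -/
theorem sobolev_legendre_zeros
    (lam : ℝ) (hlam : 0 < lam)
    (S : ℕ → Polynomial ℝ)
    (hSdeg : ∀ m, (S m).natDegree = m)
    (hSorth : ∀ m : ℕ, ∀ q : Polynomial ℝ, q.degree < (m : WithBot ℕ) →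
      (∫ x in (-1:ℝ)..1, (S m).eval x * q.eval x)
        + lam * ∫ x in (-1:ℝ)..1, (derivative (S m)).eval x * (derivative q).eval x = 0)
    (hSone : ∀ m, (S m).eval 1 = 1)
    (n : ℕ) (hn : 1 ≤ n) :
    ∃ z : Fin n → ℝ, Function.Injective z ∧ (∀ i, z i ∈ Set.Ioo (-1 : ℝ) 1) ∧
      S n = Polynomial.C ((S n).leadingCoeff) * ∏ i : Fin n, (X - Polynomial.C (z i)) := by
  have hne : S n ≠ 0 := by
    intro h
    simpa [h] using hSone n
  have hone : 0 < (S n).eval 1 := by rw [hSone]; exact one_pos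
  obtain ⟨s, hs, hdvd, hsign⟩ :=
    exists_finset_prod_dvd_and_mul_prod_constant_sign (a := -1) (b := 1) (S n) hne
  have hsone : 0 < (∏ z ∈ s, (X - C z)).eval (1 : ℝ) := by
    rw [eval_prod]
    exact Finset.prod_pos fun z hz ↦ by simpa using (hs z hz).2
  have hpos := hsign.resolve_right fun h ↦
    (mul_pos hone hsone).not_ge (h 1 (by norm_num))
  have hle : n ≤ s.card := le_card_of_sobolev_orthogonal hlam (hSorth n) hone s hs hpos
  have hge : s.card ≤ n := by
    simpa [hSdeg] using natDegree_le_of_dvd hdvd hne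
  let e : Fin n ≃ s := (s.equivFinOfCardEq (hge.antisymm hle)).symm
  refine ⟨fun i ↦ e i, Subtype.val_injective.comp e.injective, fun i ↦ hs _ (e i).2, ?_⟩
  rw [e.prod_comp (fun z : s ↦ X - C (z : ℝ)), Finset.prod_coe_sort s (fun z ↦ X - C z)]
  exact eq_leadingCoeff_mul_of_monic_of_dvd_of_natDegree_le (monic_prod_X_sub_C _ s) hdvd
    (by simpa [hSdeg] using hle)
end

section
/- Under the stated assumptions, for all polynomials f and g: (1) ⟨φ f, g⟩_S = ⟨f, F g⟩; and (2) the operator F is self-adjoint with respect to the Sobolev inner product, i.e. ⟨F f, g⟩_S = ⟨f, F g⟩_S. -/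
open Polynomial MeasureTheory Filter Topology

/-- The filter of real numbers approaching the (possibly infinite) endpoint `a` from the right. -/
noncomputable def atRightE (a : EReal) : Filter ℝ :=
  Filter.comap (fun x : ℝ => (x : EReal)) (nhdsWithin a (Set.Ioi a))

/-- The filter of real numbers approaching the (possibly infinite) endpoint `b` from the left. -/
noncomputable def atLeftE (b : EReal) : Filter ℝ :=
  Filter.comap (fun x : ℝ => (x : EReal)) (nhdsWithin b (Set.Iio b))

open intervalIntegral in
/-- A function on `(a, b)` with integrable derivative and vanishing limits at both endpoints has
a derivative of integral zero. -/
theorem setIntegral_eq_zero_of_hasDerivAt_of_tendsto_zero {a b : EReal} (hab : a < b)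
    {G G' : ℝ → ℝ}
    (hderiv : ∀ x ∈ {x : ℝ | a < (x : EReal) ∧ (x : EReal) < b}, HasDerivAt G (G' x) x)
    (hint : IntegrableOn G' {x : ℝ | a < (x : EReal) ∧ (x : EReal) < b})
    (ha : Tendsto G (atRightE a) (𝓝 0)) (hb : Tendsto G (atLeftE b) (𝓝 0)) :
    ∫ x in {x : ℝ | a < (x : EReal) ∧ (x : EReal) < b}, G' x = 0 := by
  set I : Set ℝ := {x : ℝ | a < (x : EReal) ∧ (x : EReal) < b}
  have hImeas : MeasurableSet I :=
    (measurableSet_lt measurable_const measurable_coe_real_ereal).inter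
      (measurableSet_lt measurable_coe_real_ereal measurable_const)
  have left_lt : ∀ c : EReal, a < c → ∀ᶠ x : ℝ in atRightE a, a < (x : EReal) ∧ (x : EReal) < c :=
    fun c hc => tendsto_comap.eventually (Ioo_mem_nhdsGT hc)
  have right_gt : ∀ c : EReal, c < b → ∀ᶠ x : ℝ in atLeftE b, c < (x : EReal) ∧ (x : EReal) < b :=
    fun c hc => tendsto_comap.eventually (Ioo_mem_nhdsLT hc)
  have : (atRightE a).NeBot := by
    refine comap_neBot_iff.2 fun t ht => ?_
    obtain ⟨c, hc, hct⟩ := (mem_nhdsGT_iff_exists_Ioo_subset' hab).1 ht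
    obtain ⟨x, hx⟩ := EReal.lt_iff_exists_real_btwn.1 hc
    exact ⟨x, hct hx⟩
  have : (atLeftE b).NeBot := by
    refine comap_neBot_iff.2 fun t ht => ?_
    obtain ⟨c, hc, hct⟩ := (mem_nhdsLT_iff_exists_Ioo_subset' hab).1 ht
    obtain ⟨x, hx⟩ := EReal.lt_iff_exists_real_btwn.1 hc
    exact ⟨x, hct hx⟩
  have : (atRightE a).IsCountablyGenerated := by unfold atRightE; infer_instance
  have : (atLeftE b).IsCountablyGenerated := by unfold atLeftE; infer_instance
  have hcover : AECover (volume.restrict I) (atRightE a ×ˢ atLeftE b)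
      (fun p : ℝ × ℝ => Set.Ioc p.1 p.2) := by
    refine ⟨?_, fun _ => measurableSet_Ioc⟩
    filter_upwards [ae_restrict_mem hImeas] with x hx
    filter_upwards [(left_lt x hx.1).prod_mk (right_gt x hx.2)] with p hp
    exact ⟨EReal.coe_lt_coe_iff.1 hp.1.2, (EReal.coe_lt_coe_iff.1 hp.2.1).le⟩
  have hlim := hcover.integral_tendsto_of_countably_generated hint
  have hG : Tendsto (fun p : ℝ × ℝ => G p.2 - G p.1) (atRightE a ×ˢ atLeftE b) (𝓝 0) := by
    simpa using (hb.comp tendsto_snd).sub (ha.comp tendsto_fst)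
  refine tendsto_nhds_unique hlim (hG.congr' ?_)
  obtain ⟨c, hc⟩ := EReal.lt_iff_exists_real_btwn.1 hab
  filter_upwards [(left_lt c hc.1).prod_mk (right_gt c hc.2)] with p hp
  have hle : p.1 ≤ p.2 := EReal.coe_le_coe_iff.1 (hp.1.2.trans hp.2.1).le
  have hsub : Set.Icc p.1 p.2 ⊆ I := fun x hx =>
    ⟨hp.1.1.trans_le (EReal.coe_le_coe_iff.2 hx.1),
      (EReal.coe_le_coe_iff.2 hx.2).trans_lt hp.2.2⟩
  have hsub' : Set.Ioc p.1 p.2 ⊆ I := Set.Ioc_subset_Icc_self.trans hsub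
  rw [Measure.restrict_restrict measurableSet_Ioc, Set.inter_eq_self_of_subset_left hsub',
    ← integral_of_le hle]
  refine (integral_eq_sub_of_hasDerivAt (fun x hx => hderiv x (hsub ?_)) ?_).symm
  · rwa [Set.uIcc_of_le hle] at hx
  · exact (intervalIntegrable_iff_integrableOn_Ioc_of_le hle).2 (hint.mono_set hsub')

/-- If all moments of `u` are finite then `p * u` is integrable for every polynomial `p`. -/
theorem integrableOn_eval_mul_of_moments {I : Set ℝ} {u : ℝ → ℝ}
    (hmom : ∀ k : ℕ, IntegrableOn (fun x => x ^ k * u x) I) (p : ℝ[X]) :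
    IntegrableOn (fun x => p.eval x * u x) I := by
  induction p using Polynomial.induction_on' with
  | add p q hp hq =>
    simp only [eval_add, add_mul]
    exact Integrable.add hp hq
  | monomial n c =>
    simp only [eval_monomial, mul_assoc]
    exact Integrable.const_mul (hmom n) c

/-- With ⟨f,g⟩ = ∫_a^b f g u, ⟨f,g⟩_S = ⟨f,g⟩ + λ⟨f',g'⟩,
F₀ g = φ g'' + (ψ − φ')g' and F g = φ·g − λ F₀ g, under the Pearson relation (φu)' = ψu and
the stated boundary vanishing conditions, one has, for all polynomials f and g:
(1) ⟨φ f, g⟩_S = ⟨f, F g⟩ and (2) ⟨F f, g⟩_S = ⟨f, F g⟩_S. -/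
theorem sobolev_integration_by_parts
    (a b : EReal) (hab : a < b)
    (I : Set ℝ) (hI : I = {x : ℝ | a < (x : EReal) ∧ (x : EReal) < b})
    (u : ℝ → ℝ) (hupos : ∀ x ∈ I, 0 < u x)
    (hmom : ∀ k : ℕ, IntegrableOn (fun x => x ^ k * u x) I)
    (φ ψ : Polynomial ℝ) (hφ : φ.Monic) (hψ : 1 ≤ ψ.natDegree)
    (hpearson : ∀ x ∈ I, HasDerivAt (fun y => φ.eval y * u y) (ψ.eval x * u x) x)
    (lam : ℝ) (hlam : 0 < lam)
    (F0 : Polynomial ℝ → Polynomial ℝ)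
    (hF0 : ∀ g, F0 g = φ * derivative (derivative g) + (ψ - derivative φ) * derivative g)
    (F : Polynomial ℝ → Polynomial ℝ)
    (hF : ∀ g, F g = φ * g - Polynomial.C lam * F0 g)
    (hbd1 : ∀ p : Polynomial ℝ,
      Tendsto (fun x => φ.eval x * u x * p.eval x) (atRightE a) (𝓝 0) ∧
      Tendsto (fun x => φ.eval x * u x * p.eval x) (atLeftE b) (𝓝 0))
    (hbd2 : ∀ p q : Polynomial ℝ,
      Tendsto (fun x => u x * (F0 p).eval x * q.eval x) (atRightE a) (𝓝 0) ∧
      Tendsto (fun x => u x * (F0 p).eval x * q.eval x) (atLeftE b) (𝓝 0))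
    (ip : Polynomial ℝ → Polynomial ℝ → ℝ)
    (hip : ∀ f g, ip f g = ∫ x in I, f.eval x * g.eval x * u x)
    (ipS : Polynomial ℝ → Polynomial ℝ → ℝ)
    (hipS : ∀ f g, ipS f g = ip f g + lam * ip (derivative f) (derivative g)) :
    ∀ f g : Polynomial ℝ,
      ipS (φ * f) g = ip f (F g) ∧ ipS (F f) g = ipS f (F g) := by
  subst hI
  have hintegrable := integrableOn_eval_mul_of_moments hmom
  have hzero : ∀ p : ℝ[X],
      ∫ x in {x : ℝ | a < (x : EReal) ∧ (x : EReal) < b},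
        (ψ * p + φ * derivative p).eval x * u x = 0 := fun p =>
    setIntegral_eq_zero_of_hasDerivAt_of_tendsto_zero hab
      (fun x hx => ((hpearson x hx).mul (p.hasDerivAt x)).congr_deriv (by
        simp only [eval_add, eval_mul]; ring))
      (hintegrable _) (hbd1 p).1 (hbd1 p).2
  let L : ℝ[X] →ₗ[ℝ] ℝ :=
    { toFun := fun p => ∫ x in {x : ℝ | a < (x : EReal) ∧ (x : EReal) < b}, p.eval x * u x
      map_add' := fun p q => by
        simp only [eval_add, add_mul]
        exact integral_add (hintegrable p) (hintegrable q)
      map_smul' := fun c p => by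
        simp only [eval_smul, smul_eq_mul, mul_assoc, integral_const_mul, RingHom.id_apply] }
  have hL : ∀ p, L (ψ * p + φ * derivative p) = 0 := hzero
  have hipL : ∀ f g, ip f g = L (f * g) := fun f g => by
    rw [hip]; simp only [L, LinearMap.coe_mk, AddHom.coe_mk, eval_mul]
  have hS : ∀ f g, ipS f g = L (f * g + C lam * (derivative f * derivative g)) := fun f g => by
    rw [hipS, hipL, hipL, ← smul_eq_C_mul, map_add, map_smul, smul_eq_mul]
  have heq : ∀ p q r : ℝ[X], p - q = C lam * (ψ * r + φ * derivative r) → L p = L q := by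
    intro p q r h
    rw [← sub_eq_zero, ← map_sub, h, ← smul_eq_C_mul, map_smul, hL, smul_zero]
  intro f g
  constructor
  · rw [hS, hipL]
    refine heq _ _ (f * derivative g) ?_
    simp only [hF, hF0, derivative_mul]
    ring
  · rw [hS, hS]
    refine heq _ _ (f * derivative g - g * derivative f - C lam *
      (derivative (derivative f) * derivative g - derivative f * derivative (derivative g))) ?_
    simp only [hF, hF0, derivative_mul, derivative_sub, derivative_add, derivative_C]
    ring
end

section
/- If {dμ_0, dμ_1} is a coherent pair with coherence coefficients a_n, then for every λ > 0 and every n ≥ 2, S_n(x;λ) + b_{n−1}(λ) S_{n−1}(x;λ) = P_n(x;dμ_0) + â_{n−1} P_{n−1}(x;dμ_0), where â_{n−1} = n a_{n−1}/(n−1) and b_{n−1}(λ) = â_{n−1} ‖P_{n−1}(·;dμ_0)‖²_{dμ_0} / ‖S_{n−1}(·;λ)‖²_λ. -/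
open Polynomial MeasureTheory

/-- Polynomials are integrable with respect to a measure with finite moments. -/
lemma integrable_polynomial_eval {μ : Measure ℝ}
    (hint : ∀ k : ℕ, Integrable (fun x => x ^ k) μ) (p : ℝ[X]) :
    Integrable (fun x => p.eval x) μ := by
  simp only [eval_eq_sum_range]
  exact integrable_finsetSum _ fun i _ => (hint i).const_mul _

/-- The moment functional `p ↦ ∫ p dμ` of a measure with finite moments. -/
noncomputable def momentFunctional (μ : Measure ℝ)
    (hint : ∀ k : ℕ, Integrable (fun x => x ^ k) μ) : ℝ[X] →ₗ[ℝ] ℝ where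
  toFun p := ∫ x, p.eval x ∂μ
  map_add' p q := by
    simp only [eval_add]
    exact integral_add (integrable_polynomial_eval hint p) (integrable_polynomial_eval hint q)
  map_smul' c p := by
    simp only [eval_smul, smul_eq_mul, RingHom.id_apply]
    exact integral_const_mul c _

/-- Subtracting the right multiple of a monic polynomial of degree `m` lowers the degree of a
polynomial of degree at most `m`. -/
lemma degree_sub_C_coeff_mul_lt {m : ℕ} {p q : ℝ[X]} (hp : p.Monic) (hpm : p.natDegree = m)
    (hq : q.degree < ((m + 1 : ℕ) : WithBot ℕ)) :
    (q - C (q.coeff m) * p).degree < (m : WithBot ℕ) := by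
  rw [degree_lt_iff_coeff_zero] at hq ⊢
  intro k hk
  rcases hk.eq_or_lt with rfl | hk
  · have : p.coeff m = 1 := by rw [← hpm]; exact hp
    simp [this]
  · simp [hq k hk, coeff_eq_zero_of_natDegree_lt (hpm.trans_lt hk)]

/-- If {dμ₀, dμ₁} is a coherent pair with coherence coefficients a_n, then for
every λ > 0 and every n ≥ 2,
S_n(x;λ) + b_{n−1}(λ) S_{n−1}(x;λ) = P_n(x;dμ₀) + â_{n−1} P_{n−1}(x;dμ₀),
where â_{n−1} = n a_{n−1}/(n−1) and
b_{n−1}(λ) = â_{n−1} ‖P_{n−1}(·;dμ₀)‖²_{dμ₀} / ‖S_{n−1}(·;λ)‖²_λ. -/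
theorem coherent_pair_sobolev_relation
    (μ0 μ1 : Measure ℝ)
    (hint0 : ∀ k : ℕ, Integrable (fun x => x ^ k) μ0)
    (hint1 : ∀ k : ℕ, Integrable (fun x => x ^ k) μ1)
    (hpos0 : ∀ p : Polynomial ℝ, p ≠ 0 → 0 < ∫ x, (p.eval x) ^ 2 ∂μ0)
    (hpos1 : ∀ p : Polynomial ℝ, p ≠ 0 → 0 < ∫ x, (p.eval x) ^ 2 ∂μ1)
    -- monic orthogonal polynomials with respect to μ0 and μ1
    (P0 P1 : ℕ → Polynomial ℝ)
    (hP0monic : ∀ n, (P0 n).Monic) (hP0deg : ∀ n, (P0 n).natDegree = n)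
    (hP0orth : ∀ n : ℕ, ∀ q : Polynomial ℝ, q.degree < (n : WithBot ℕ) →
      ∫ x, (P0 n).eval x * q.eval x ∂μ0 = 0)
    (hP1monic : ∀ n, (P1 n).Monic) (hP1deg : ∀ n, (P1 n).natDegree = n)
    (hP1orth : ∀ n : ℕ, ∀ q : Polynomial ℝ, q.degree < (n : WithBot ℕ) →
      ∫ x, (P1 n).eval x * q.eval x ∂μ1 = 0)
    -- coherence: P_n(·;dμ₁) = P'_{n+1}(·;dμ₀)/(n+1) + a_n P'_n(·;dμ₀)/n
    (a : ℕ → ℝ) (ha : ∀ n : ℕ, 1 ≤ n → a n ≠ 0)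
    (hcoh : ∀ n : ℕ, 1 ≤ n →
      P1 n = Polynomial.C (((n : ℝ) + 1)⁻¹) * derivative (P0 (n + 1))
           + Polynomial.C (a n / (n : ℝ)) * derivative (P0 n))
    -- the Sobolev inner product and its monic orthogonal polynomials
    (lam : ℝ) (hlam : 0 < lam)
    (ipS : Polynomial ℝ → Polynomial ℝ → ℝ)
    (hipS : ∀ f g, ipS f g = (∫ x, f.eval x * g.eval x ∂μ0)
      + lam * ∫ x, (derivative f).eval x * (derivative g).eval x ∂μ1)
    (S : ℕ → Polynomial ℝ)
    (hSmonic : ∀ n, (S n).Monic) (hSdeg : ∀ n, (S n).natDegree = n)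
    (hSorth : ∀ n : ℕ, ∀ q : Polynomial ℝ, q.degree < (n : WithBot ℕ) → ipS (S n) q = 0)
    (n : ℕ) (hn : 2 ≤ n) :
    S n + Polynomial.C (((n : ℝ) * a (n - 1) / ((n : ℝ) - 1))
            * (∫ x, ((P0 (n - 1)).eval x) ^ 2 ∂μ0) / ipS (S (n - 1)) (S (n - 1))) * S (n - 1)
      = P0 n + Polynomial.C ((n : ℝ) * a (n - 1) / ((n : ℝ) - 1)) * P0 (n - 1) := by
  obtain ⟨m, rfl⟩ : ∃ m, n = m + 1 := ⟨n - 1, by omega⟩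
  have hm : 1 ≤ m := by omega
  have hm0 : (m : ℝ) ≠ 0 := by positivity
  simp only [Nat.add_sub_cancel, Nat.cast_add, Nat.cast_one, add_sub_cancel_right]
  set L0 := momentFunctional μ0 hint0
  set L1 := momentFunctional μ1 hint1
  have hL0 (f g : ℝ[X]) : ∫ x, f.eval x * g.eval x ∂μ0 = L0 (f * g) := by
    simp [L0, momentFunctional]
  have hL1 (f g : ℝ[X]) : ∫ x, f.eval x * g.eval x ∂μ1 = L1 (f * g) := by
    simp [L1, momentFunctional]
  have hsq : ∫ x, ((P0 m).eval x) ^ 2 ∂μ0 = L0 (P0 m * P0 m) := by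
    simp only [pow_two, hL0]
  have hip (f g : ℝ[X]) : ipS f g = L0 (f * g) + lam * L1 (derivative f * derivative g) := by
    rw [hipS, hL0, hL1]
  have ip_sub_left (f g q : ℝ[X]) : ipS (f - g) q = ipS f q - ipS g q := by
    simp only [hip, sub_mul, map_sub]; ring
  have ip_C_left (c : ℝ) (f q : ℝ[X]) : ipS (C c * f) q = c * ipS f q := by
    simp only [hip, ← smul_eq_C_mul, map_smul, smul_mul_assoc,
      smul_eq_mul]; ring
  have ip_comm (f g : ℝ[X]) : ipS f g = ipS g f := by
    simp only [hip, mul_comm]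
  have ip_pos (f : ℝ[X]) (hf : f ≠ 0) : 0 < ipS f f := by
    have h0 := hpos0 f hf
    have h1 : 0 ≤ ∫ x, (derivative f).eval x * (derivative f).eval x ∂μ1 :=
      integral_nonneg fun x => mul_self_nonneg _
    simp only [pow_two] at h0
    rw [hipS]
    positivity
  set A : ℝ := ((m : ℝ) + 1) * a m / (m : ℝ) with hA
  rw [hsq]
  set K := ipS (S m) (S m) with hK
  have hK0 : K ≠ 0 := (ip_pos _ (hSmonic m).ne_zero).ne'
  set Q := P0 (m + 1) + C A * P0 m with hQ
  have hQ' : derivative Q = C ((m : ℝ) + 1) * P1 m := by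
    have h1 : ((m : ℝ) + 1) * ((m : ℝ) + 1)⁻¹ = 1 := mul_inv_cancel₀ (by positivity)
    rw [hcoh m hm, mul_add, ← mul_assoc, ← mul_assoc, ← C_mul, ← C_mul, h1, hQ, hA,
      derivative_add, derivative_C_mul, mul_div_assoc, C_1, one_mul]
  have ip_Q (q : ℝ[X]) (hq : q.degree < ((m + 1 : ℕ) : WithBot ℕ)) :
      ipS Q q = A * L0 (P0 m * q) := by
    have hd : (derivative q).degree < (m : WithBot ℕ) := by
      rw [degree_lt_iff_coeff_zero] at hq ⊢
      intro k hk
      simp [coeff_derivative, hq (k + 1) (by omega)]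
    have h0 := hP0orth (m + 1) q hq
    have h1 := hP1orth m _ hd
    rw [hL0] at h0
    rw [hL1] at h1
    rw [hip, hQ', hQ]
    simp only [add_mul, ← smul_eq_C_mul, map_add, map_smul, smul_mul_assoc,
      smul_eq_mul, h0, h1]
    ring
  have L0_monic (p : ℝ[X]) (hp : p.Monic) (hpm : p.natDegree = m) :
      L0 (P0 m * p) = L0 (P0 m * P0 m) := by
    have hlt : (p - P0 m).degree < (m : WithBot ℕ) := by
      have hc : p.coeff m = 1 := by rw [← hpm]; exact hp
      have hdeg : p.degree < ((m + 1 : ℕ) : WithBot ℕ) := by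
        rw [degree_eq_natDegree hp.ne_zero, hpm]; exact_mod_cast Nat.lt_succ_self m
      simpa [hc] using degree_sub_C_coeff_mul_lt (hP0monic m) (hP0deg m) hdeg
    have h := hP0orth m _ hlt
    rw [hL0, mul_sub, map_sub] at h
    linarith
  set b : ℝ := A * L0 (P0 m * P0 m) / K with hb
  set R := Q - S (m + 1) - C b * S m with hR
  have lt_succ : ∀ p : ℝ[X], p.natDegree = m → p.degree < ((m + 1 : ℕ) : WithBot ℕ) := by
    intro p hp
    refine (degree_le_natDegree).trans_lt ?_
    rw [hp]; exact_mod_cast Nat.lt_succ_self m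
  have hRdeg : R.degree < ((m + 1 : ℕ) : WithBot ℕ) := by
    have hcP : (P0 (m + 1)).coeff (m + 1) = 1 := by
      have := hP0monic (m + 1); rwa [Monic, leadingCoeff, hP0deg] at this
    have hcS : (S (m + 1)).coeff (m + 1) = 1 := by
      have := hSmonic (m + 1); rwa [Monic, leadingCoeff, hSdeg] at this
    rw [degree_lt_iff_coeff_zero]
    intro k hk
    have h1 : (P0 m).coeff k = 0 := coeff_eq_zero_of_natDegree_lt (by rw [hP0deg]; omega)
    have h2 : (S m).coeff k = 0 := coeff_eq_zero_of_natDegree_lt (by rw [hSdeg]; omega)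
    rcases hk.eq_or_lt with rfl | hk
    · simp [hR, hQ, h1, h2, hcP, hcS]
    · have h3 : (P0 (m + 1)).coeff k = 0 := coeff_eq_zero_of_natDegree_lt (by rwa [hP0deg])
      have h4 : (S (m + 1)).coeff k = 0 := coeff_eq_zero_of_natDegree_lt (by rwa [hSdeg])
      simp [hR, hQ, h1, h2, h3, h4]
  have ip_R_lt (q : ℝ[X]) (hq : q.degree < (m : WithBot ℕ)) : ipS R q = 0 := by
    have hq' : q.degree < ((m + 1 : ℕ) : WithBot ℕ) :=
      hq.trans (by exact_mod_cast Nat.lt_succ_self m)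
    have h := hP0orth m q hq
    rw [hL0] at h
    rw [hR, ip_sub_left, ip_sub_left, ip_C_left, ip_Q q hq', hSorth _ q hq', hSorth _ q hq, h]
    ring
  have ip_R_S : ipS R (S m) = 0 := by
    have hS := lt_succ _ (hSdeg m)
    rw [hR, ip_sub_left, ip_sub_left, ip_C_left, ip_Q _ hS, hSorth _ _ hS,
      L0_monic _ (hSmonic m) (hSdeg m), ← hK, hb]
    field_simp
    ring
  have hRR : ipS R R = 0 := by
    have h := ip_R_lt _ (degree_sub_C_coeff_mul_lt (hSmonic m) (hSdeg m) hRdeg)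
    rw [ip_comm, ip_sub_left, ip_C_left, ip_comm (S m), ip_R_S] at h
    linarith
  have hR0 : R = 0 := by
    by_contra h
    exact (ip_pos R h).ne' hRR
  rw [hR] at hR0
  linear_combination -hR0
end

section
/- The following are equivalent: (a) {dμ_0, dμ_1} is a generalized coherent pair, i.e. there exist nonzero real numbers a_n and real numbers b_{n−1} (n ≥ 1) such that P_n(x;dμ_1) + b_{n−1} P_{n−1}(x;dμ_1) = P'_{n+1}(x;dμ_0)/(n+1) + a_n P'_n(x;dμ_0)/n for all n ≥ 1; (b) there exist nonzero real numbers a_n (n ≥ 1) such that for every λ > 0 and every n ≥ 1 there is a real number c_n(λ) with S_{n+1}(x;λ) + c_n(λ) S_n(x;λ) = P_{n+1}(x;dμ_0) + ((n+1)a_n/n) P_n(x;dμ_0). -/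
open Polynomial MeasureTheory

/-- Polynomials are integrable with respect to a measure with finite moments. -/
lemma integrable_eval_of_moments {μ : Measure ℝ} (h : ∀ k : ℕ, Integrable (fun x => x ^ k) μ)
    (p : ℝ[X]) : Integrable (fun x => p.eval x) μ := by
  simp only [eval_eq_sum_range]
  exact integrable_finsetSum _ fun k _ => (h k).const_mul _

/-- The bilinear form `(f, g) ↦ ∫ f g dμ` on polynomials. -/
noncomputable def momentForm (μ : Measure ℝ) (h : ∀ k : ℕ, Integrable (fun x => x ^ k) μ) :
    LinearMap.BilinForm ℝ ℝ[X] :=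
  have hi (p q : ℝ[X]) : Integrable (fun x => p.eval x * q.eval x) μ := by
    simpa using integrable_eval_of_moments h (p * q)
  LinearMap.mk₂ ℝ (fun p q => ∫ x, p.eval x * q.eval x ∂μ)
    (fun p₁ p₂ q => by simp only [eval_add, add_mul]; exact integral_add (hi p₁ q) (hi p₂ q))
    (fun c p q => by simp only [eval_smul, smul_eq_mul, mul_assoc]; exact integral_const_mul _ _)
    (fun p q₁ q₂ => by simp only [eval_add, mul_add]; exact integral_add (hi p q₁) (hi p q₂))
    (fun c p q => by
      simp only [eval_smul, smul_eq_mul, mul_left_comm _ c]; exact integral_const_mul _ _)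

lemma momentForm_apply {μ : Measure ℝ} (h : ∀ k : ℕ, Integrable (fun x => x ^ k) μ)
    (p q : ℝ[X]) : momentForm μ h p q = ∫ x, p.eval x * q.eval x ∂μ := rfl

lemma degree_sub_lt_of_monic {p q : ℝ[X]} {n : ℕ} (hp : p.Monic) (hq : q.Monic)
    (hpn : p.natDegree = n) (hqn : q.natDegree = n) : (p - q).degree < (n : WithBot ℕ) := by
  have hpd : p.degree = n := by rw [degree_eq_natDegree hp.ne_zero, hpn]
  have hqd : q.degree = n := by rw [degree_eq_natDegree hq.ne_zero, hqn]
  rw [← hpd]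
  exact degree_sub_lt_left (hpd.trans hqd.symm) hp.ne_zero (hp.trans hq.symm)

/-- A polynomial of degree at most `n` that is orthogonal to all polynomials of degree less
than `n` is a multiple of the monic orthogonal polynomial of degree `n`. -/
lemma eq_C_mul_of_orthogonal (B : LinearMap.BilinForm ℝ ℝ[X]) (hB : ∀ f, f ≠ 0 → 0 < B f f)
    {p r : ℝ[X]} {n : ℕ} (hp : p.Monic) (hpn : p.natDegree = n)
    (hpo : ∀ q : ℝ[X], q.degree < (n : WithBot ℕ) → B p q = 0)
    (hr : r.degree < ((n + 1 : ℕ) : WithBot ℕ))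
    (hro : ∀ q : ℝ[X], q.degree < (n : WithBot ℕ) → B r q = 0) :
    r = C (r.coeff n) * p := by
  have hd : (r - r.coeff n • p).degree < (n : WithBot ℕ) := by
    rw [degree_lt_iff_coeff_zero] at hr ⊢
    intro m hm
    have hpc : p.coeff n = 1 := by rw [← hpn]; exact hp
    rcases hm.eq_or_lt with rfl | hm
    · simp [hpc]
    · simp [hr m hm, coeff_eq_zero_of_natDegree_lt (hpn.trans_lt hm)]
  rw [← smul_eq_C_mul, ← sub_eq_zero]
  by_contra hne
  have horth (q : ℝ[X]) (hq : q.degree < (n : WithBot ℕ)) : B (r - r.coeff n • p) q = 0 := by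
    simp [hpo _ hq, hro _ hq]
  exact (hB _ hne).ne' (horth _ hd)

/-- Every polynomial of degree less than `n` has an antiderivative of degree less than `n + 1`. -/
lemma exists_derivative_eq {r : ℝ[X]} {n : ℕ} (hr : r.degree < (n : WithBot ℕ)) :
    ∃ q : ℝ[X], q.degree < ((n + 1 : ℕ) : WithBot ℕ) ∧ derivative q = r := by
  refine ⟨∑ i ∈ Finset.range n, C (r.coeff i / (i + 1)) * X ^ (i + 1), ?_, ?_⟩
  · refine (degree_sum_le _ _).trans_lt ((Finset.sup_lt_iff (WithBot.bot_lt_coe _)).2 ?_)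
    intro i hi
    refine (degree_C_mul_X_pow_le _ _).trans_lt ?_
    exact_mod_cast Nat.succ_lt_succ (Finset.mem_range.1 hi)
  · ext k
    have hk : ((k : ℝ) + 1) ≠ 0 := by positivity
    simp only [coeff_derivative, finsetSum_coeff, coeff_C_mul_X_pow, add_left_inj]
    rw [Finset.sum_ite_eq]
    split_ifs with h
    · rw [div_mul_cancel₀ _ hk]
    · rw [zero_mul, (degree_lt_iff_coeff_zero r n).1 hr k (by simpa using h)]

lemma degree_derivative_lt_of_degree_lt_succ {q : ℝ[X]} {n : ℕ}
    (hq : q.degree < ((n + 1 : ℕ) : WithBot ℕ)) : (derivative q).degree < (n : WithBot ℕ) := by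
  rw [degree_lt_iff_coeff_zero] at hq ⊢
  intro m hm
  rw [coeff_derivative, hq (m + 1) (by omega), zero_mul]

/-- {dμ₀, dμ₁} is a generalized coherent pair (i.e. there exist nonzero a_n and
real b_{n−1} with P_n(·;dμ₁) + b_{n−1} P_{n−1}(·;dμ₁) = P'_{n+1}(·;dμ₀)/(n+1) + a_n P'_n(·;dμ₀)/n
for all n ≥ 1) if and only if there exist nonzero a_n such that for every λ > 0 and n ≥ 1 there
is c_n(λ) with S_{n+1}(·;λ) + c_n(λ) S_n(·;λ) = P_{n+1}(·;dμ₀) + ((n+1)a_n/n) P_n(·;dμ₀). -/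
theorem generalized_coherent_pair_iff
    (μ0 μ1 : Measure ℝ)
    (hint0 : ∀ k : ℕ, Integrable (fun x => x ^ k) μ0)
    (hint1 : ∀ k : ℕ, Integrable (fun x => x ^ k) μ1)
    (hpos0 : ∀ p : Polynomial ℝ, p ≠ 0 → 0 < ∫ x, (p.eval x) ^ 2 ∂μ0)
    (hpos1 : ∀ p : Polynomial ℝ, p ≠ 0 → 0 < ∫ x, (p.eval x) ^ 2 ∂μ1)
    (P0 P1 : ℕ → Polynomial ℝ)
    (hP0monic : ∀ n, (P0 n).Monic) (hP0deg : ∀ n, (P0 n).natDegree = n)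
    (hP0orth : ∀ n : ℕ, ∀ q : Polynomial ℝ, q.degree < (n : WithBot ℕ) →
      ∫ x, (P0 n).eval x * q.eval x ∂μ0 = 0)
    (hP1monic : ∀ n, (P1 n).Monic) (hP1deg : ∀ n, (P1 n).natDegree = n)
    (hP1orth : ∀ n : ℕ, ∀ q : Polynomial ℝ, q.degree < (n : WithBot ℕ) →
      ∫ x, (P1 n).eval x * q.eval x ∂μ1 = 0)
    -- for every λ > 0, S λ is the sequence of monic Sobolev orthogonal polynomials
    (S : ℝ → ℕ → Polynomial ℝ)
    (hSmonic : ∀ lam : ℝ, 0 < lam → ∀ n, (S lam n).Monic)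
    (hSdeg : ∀ lam : ℝ, 0 < lam → ∀ n, (S lam n).natDegree = n)
    (hSorth : ∀ lam : ℝ, 0 < lam → ∀ n : ℕ, ∀ q : Polynomial ℝ, q.degree < (n : WithBot ℕ) →
      (∫ x, (S lam n).eval x * q.eval x ∂μ0)
        + lam * ∫ x, (derivative (S lam n)).eval x * (derivative q).eval x ∂μ1 = 0) :
    (∃ a b : ℕ → ℝ, (∀ n : ℕ, 1 ≤ n → a n ≠ 0) ∧
      ∀ n : ℕ, 1 ≤ n →
        P1 n + Polynomial.C (b (n - 1)) * P1 (n - 1)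
          = Polynomial.C (((n : ℝ) + 1)⁻¹) * derivative (P0 (n + 1))
            + Polynomial.C (a n / (n : ℝ)) * derivative (P0 n))
    ↔
    (∃ a : ℕ → ℝ, (∀ n : ℕ, 1 ≤ n → a n ≠ 0) ∧
      ∀ lam : ℝ, 0 < lam → ∀ n : ℕ, 1 ≤ n → ∃ c : ℝ,
        S lam (n + 1) + Polynomial.C c * S lam n
          = P0 (n + 1) + Polynomial.C (((n : ℝ) + 1) * a n / (n : ℝ)) * P0 n) := by
  set B0 := momentForm μ0 hint0 with hB0
  set B1 := momentForm μ1 hint1 with hB1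
  have hB0pos (f : ℝ[X]) (hf : f ≠ 0) : 0 < B0 f f := by
    simpa only [hB0, momentForm_apply, ← sq] using hpos0 f hf
  have hB1pos (f : ℝ[X]) (hf : f ≠ 0) : 0 < B1 f f := by
    simpa only [hB1, momentForm_apply, ← sq] using hpos1 f hf
  have hB1nonneg (f : ℝ[X]) : 0 ≤ B1 f f := by
    rcases eq_or_ne f 0 with rfl | hf
    · simp
    · exact (hB1pos f hf).le
  have hP0B (n : ℕ) (q : ℝ[X]) (hq : q.degree < (n : WithBot ℕ)) : B0 (P0 n) q = 0 :=
    hP0orth n q hq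
  have hP1B (n : ℕ) (q : ℝ[X]) (hq : q.degree < (n : WithBot ℕ)) : B1 (P1 n) q = 0 :=
    hP1orth n q hq
  have hQB (n : ℕ) (t : ℝ) (q : ℝ[X]) (hq : q.degree < (n : WithBot ℕ)) :
      B0 (P0 (n + 1) + C t * P0 n) q = 0 := by
    have hq' : q.degree < ((n + 1 : ℕ) : WithBot ℕ) :=
      hq.trans (by exact_mod_cast n.lt_succ_self)
    simp [← smul_eq_C_mul, hP0B _ _ hq, hP0B _ _ hq']
  constructor
  · rintro ⟨a, b, ha, h⟩
    refine ⟨a, ha, fun lam hlam n hn => ?_⟩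
    obtain ⟨m, rfl⟩ : ∃ m, n = m + 1 := ⟨n - 1, by omega⟩
    set n := m + 1 with hnm
    have hn1 : (n : ℝ) + 1 ≠ 0 := by positivity
    set Q := P0 (n + 1) + C (((n : ℝ) + 1) * a n / (n : ℝ)) * P0 n with hQ
    have hQ' : derivative Q = C ((n : ℝ) + 1) * (P1 n + C (b (n - 1)) * P1 (n - 1)) := by
      rw [h n hn, hQ, derivative_add, derivative_C_mul, mul_add, ← mul_assoc, ← mul_assoc, ← C_mul,
        ← C_mul, mul_inv_cancel₀ hn1, C_1, one_mul, mul_div_assoc]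
    let B : LinearMap.BilinForm ℝ ℝ[X] := B0 + lam • B1.compl₁₂ derivative derivative
    have hB (f g : ℝ[X]) : B f g = B0 f g + lam * B1 (derivative f) (derivative g) := rfl
    have hBpos (f : ℝ[X]) (hf : f ≠ 0) : 0 < B f f :=
      add_pos_of_pos_of_nonneg (hB0pos f hf) (mul_nonneg hlam.le (hB1nonneg _))
    have hSB (k : ℕ) (q : ℝ[X]) (hq : q.degree < (k : WithBot ℕ)) : B (S lam k) q = 0 :=
      hSorth lam hlam k q hq
    refine ⟨(Q - S lam (n + 1)).coeff n, ?_⟩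
    rw [← eq_C_mul_of_orthogonal B hBpos (hSmonic lam hlam n) (hSdeg lam hlam n) (hSB n)
      (r := Q - S lam (n + 1)), add_sub_cancel]
    · rw [hQ, add_sub_right_comm]
      refine (degree_add_le _ _).trans_lt (max_lt (degree_sub_lt_of_monic (hP0monic _)
        (hSmonic lam hlam _) (hP0deg _) (hSdeg lam hlam _)) ?_)
      rw [← smul_eq_C_mul]
      refine (degree_smul_le _ _).trans_lt ?_
      rw [degree_eq_natDegree (hP0monic n).ne_zero, hP0deg]
      exact_mod_cast n.lt_succ_self
    · intro q hq
      have hq' : q.degree < ((n + 1 : ℕ) : WithBot ℕ) :=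
        hq.trans (by exact_mod_cast n.lt_succ_self)
      have hd : (derivative q).degree < (m : WithBot ℕ) :=
        degree_derivative_lt_of_degree_lt_succ hq
      have hd' : (derivative q).degree < (n : WithBot ℕ) :=
        hd.trans (by exact_mod_cast m.lt_succ_self)
      have h1 : B1 (derivative Q) (derivative q) = 0 := by
        have hm : n - 1 = m := Nat.add_sub_cancel m 1
        rw [hQ', hm, ← smul_eq_C_mul, ← smul_eq_C_mul]
        simp only [map_add, map_smul, LinearMap.add_apply, LinearMap.smul_apply, hP1B _ _ hd,
          hP1B _ _ hd', smul_zero, add_zero]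
      rw [map_sub, LinearMap.sub_apply, hSB _ _ hq', hB, h1, hQB _ _ _ hq]
      simp
  · rintro ⟨a, ha, h⟩
    have key (m : ℕ) : ∃ β : ℝ, P1 (m + 1) + C β * P1 m
        = C (((m + 1 : ℕ) : ℝ) + 1)⁻¹ * derivative (P0 (m + 1 + 1))
          + C (a (m + 1) / ((m + 1 : ℕ) : ℝ)) * derivative (P0 (m + 1)) := by
      obtain ⟨c, hc⟩ := h 1 one_pos (m + 1) (by omega)
      set n := m + 1 with hnm
      have hn1 : (n : ℝ) + 1 ≠ 0 := by positivity
      set Q := P0 (n + 1) + C (((n : ℝ) + 1) * a n / (n : ℝ)) * P0 n with hQ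
      have hQ' : C ((n : ℝ) + 1)⁻¹ * derivative Q =
          C ((n : ℝ) + 1)⁻¹ * derivative (P0 (n + 1)) + C (a n / (n : ℝ)) * derivative (P0 n) := by
        rw [hQ, derivative_add, derivative_C_mul, mul_add, ← mul_assoc, ← C_mul,
          mul_div_assoc, inv_mul_cancel_left₀ hn1]
      have hQ1 (r : ℝ[X]) (hr : r.degree < (m : WithBot ℕ)) : B1 (derivative Q) r = 0 := by
        obtain ⟨q, hq, rfl⟩ := exists_derivative_eq hr
        have hq' : q.degree < ((n + 1 : ℕ) : WithBot ℕ) :=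
          hq.trans (by exact_mod_cast n.lt_succ_self)
        have e1 : B0 (S 1 n) q + 1 * B1 (derivative (S 1 n)) (derivative q) = 0 :=
          hSorth 1 one_pos n q hq
        have e2 : B0 (S 1 (n + 1)) q + 1 * B1 (derivative (S 1 (n + 1))) (derivative q) = 0 :=
          hSorth 1 one_pos (n + 1) q hq'
        have e3 : B0 Q q = 0 := hQB _ _ _ hq
        rw [← hc] at e3 ⊢
        simp only [← smul_eq_C_mul, map_add, map_smul, LinearMap.add_apply, LinearMap.smul_apply,
          smul_eq_mul] at e3 ⊢
        linear_combination e2 + c * e1 - e3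
      rw [← hQ']
      refine ⟨(C ((n : ℝ) + 1)⁻¹ * derivative Q - P1 n).coeff m, ?_⟩
      rw [← eq_C_mul_of_orthogonal B1 hB1pos (hP1monic m) (hP1deg m) (hP1B m)
        (r := C ((n : ℝ) + 1)⁻¹ * derivative Q - P1 n), add_sub_cancel]
      · have hder (k : ℕ) : (derivative (P0 (k + 1))).natDegree = k := by
          rw [natDegree_derivative, hP0deg, Nat.add_sub_cancel]
        rw [hQ', add_sub_right_comm]
        refine (degree_add_le _ _).trans_lt (max_lt (degree_sub_lt_of_monic ?_
          (hP1monic _) ?_ (hP1deg _)) ?_)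
        · rw [Monic, leadingCoeff_mul, leadingCoeff_C, leadingCoeff_derivative, hP0monic, hP0deg]
          push_cast
          rw [one_mul, inv_mul_cancel₀ hn1]
        · rw [natDegree_C_mul (inv_ne_zero hn1), hder]
        · rw [← smul_eq_C_mul]
          refine (degree_smul_le _ _).trans_lt ?_
          refine degree_le_natDegree.trans_lt ?_
          rw [hnm, hder]
          exact_mod_cast m.lt_succ_self
      · intro q hq
        have hq' : q.degree < (n : WithBot ℕ) := hq.trans (by exact_mod_cast m.lt_succ_self)
        simp [← smul_eq_C_mul, hQ1 q hq, hP1B _ _ hq']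
    choose b hb using key
    refine ⟨a, b, ha, fun n hn => ?_⟩
    obtain ⟨m, rfl⟩ : ∃ m, n = m + 1 := ⟨n - 1, by omega⟩
    exact hb m
end

section
/- If {U_0, U_1} is a coherent pair of quasi-definite linear functionals, then at least one of U_0 and U_1 is classical in the extended sense; that is, for i = 0 or i = 1 there exist polynomials φ ≠ 0 with deg φ ≤ 2 and ψ with deg ψ = 1 such that ∂(φ U_i) = ψ U_i. -/
open Polynomial

/-- A linear functional on real polynomials is quasi-definite if all its Hankel (moment)
determinants are nonzero. -/
def IsQuasiDefinite (U : Polynomial ℝ →ₗ[ℝ] ℝ) : Prop :=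
  ∀ n : ℕ, (Matrix.of fun i j : Fin (n + 1) => U (Polynomial.X ^ ((i : ℕ) + (j : ℕ)))).det ≠ 0

/-- A linear functional U is classical in the extended sense if there exist polynomials
φ ≠ 0 with deg φ ≤ 2 and ψ with deg ψ = 1 such that ∂(φU) = ψU, i.e.
−U(φ p') = U(ψ p) for every polynomial p. -/
def IsClassicalExt (U : Polynomial ℝ →ₗ[ℝ] ℝ) : Prop :=
  ∃ φ ψ : Polynomial ℝ, φ ≠ 0 ∧ φ.natDegree ≤ 2 ∧ ψ.natDegree = 1 ∧
    ∀ p : Polynomial ℝ, -U (φ * Polynomial.derivative p) = U (ψ * p)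

theorem IsQuasiDefinite.eq_zero_of_forall_mul {U : Polynomial ℝ →ₗ[ℝ] ℝ} (hU : IsQuasiDefinite U)
    {q : Polynomial ℝ} (h : ∀ p, U (q * p) = 0) : q = 0 := by
  have hz : (fun j : Fin (q.natDegree + 1) => q.coeff j) = 0 := by
    refine Matrix.eq_zero_of_mulVec_eq_zero (hU q.natDegree) ?_
    funext i
    have hi := h (X ^ (i : ℕ))
    rw [congrArg (· * X ^ (i : ℕ)) q.as_sum_range_C_mul_X_pow, Finset.sum_mul, map_sum,
      Finset.sum_range] at hi
    simp only [Matrix.mulVec, dotProduct, Matrix.of_apply, Pi.zero_apply]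
    rw [← hi]
    refine Finset.sum_congr rfl fun j _ => ?_
    rw [mul_assoc, ← smul_eq_C_mul, map_smul, smul_eq_mul, mul_comm, ← pow_add, add_comm (i : ℕ)]
  have hlead := congrFun hz (Fin.last _)
  simpa using hlead

theorem IsQuasiDefinite.eq_of_forall_mul {U : Polynomial ℝ →ₗ[ℝ] ℝ} (hU : IsQuasiDefinite U)
    {q r : Polynomial ℝ} (h : ∀ p, U (q * p) = U (r * p)) : q = r :=
  sub_eq_zero.1 <| hU.eq_zero_of_forall_mul fun p => by rw [sub_mul, map_sub, h, sub_self]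

/-- For a quasi-definite functional, a Pearson equation with `φ ≠ 0`, `deg φ ≤ 2` and
`deg ψ ≤ 1` automatically has `deg ψ = 1`. -/
theorem IsQuasiDefinite.isClassicalExt {U : Polynomial ℝ →ₗ[ℝ] ℝ} (hU : IsQuasiDefinite U)
    {φ ψ : Polynomial ℝ} (hφ : φ ≠ 0) (hφ2 : φ.natDegree ≤ 2) (hψ : ψ.natDegree ≤ 1)
    (h : ∀ p, -U (φ * derivative p) = U (ψ * p)) : IsClassicalExt U := by
  refine ⟨φ, ψ, hφ, hφ2, ?_, h⟩
  by_contra hne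
  obtain ⟨c, rfl⟩ := natDegree_eq_zero.1 (show ψ.natDegree = 0 by omega)
  have h1 : U 1 ≠ 0 := by simpa using hU 0
  have hc : c = 0 := by
    have := h 1
    rw [← smul_eq_C_mul, map_smul] at this
    simpa [h1] using this
  refine hφ (hU.eq_zero_of_forall_mul fun p => ?_)
  obtain ⟨q, rfl⟩ : ∃ q : Polynomial ℝ, derivative q = p := by
    induction p using Polynomial.induction_on' with
    | add p q hp hq =>
      obtain ⟨a, rfl⟩ := hp
      obtain ⟨b, rfl⟩ := hq
      exact ⟨a + b, derivative_add⟩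
    | monomial n a =>
      refine ⟨monomial (n + 1) (a / (n + 1)), ?_⟩
      rw [derivative_monomial]
      congr 1
      push_cast
      field_simp
  simpa [hc] using h q

/-- The relation `∂(C U₁) = D U₀` between linear functionals. -/
def DerivRel (U0 U1 : Polynomial ℝ →ₗ[ℝ] ℝ) (C D : Polynomial ℝ) : Prop :=
  ∀ p : Polynomial ℝ, -U1 (C * derivative p) = U0 (D * p)

namespace DerivRel

variable {U0 U1 : Polynomial ℝ →ₗ[ℝ] ℝ} {C D E F : Polynomial ℝ}

theorem smul (h : DerivRel U0 U1 C D) (c : ℝ) : DerivRel U0 U1 (c • C) (c • D) := fun p => by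
  rw [smul_mul_assoc, smul_mul_assoc, map_smul, map_smul, ← h p, smul_neg]

theorem sub (h : DerivRel U0 U1 C D) (k : DerivRel U0 U1 E F) :
    DerivRel U0 U1 (C - E) (D - F) := fun p => by
  rw [sub_mul, sub_mul, map_sub, map_sub, ← h p, ← k p]
  ring

/-- Eliminating `∂U₁` from two relations yields the Wronskian relation. -/
theorem wronskian (h : DerivRel U0 U1 C D) (k : DerivRel U0 U1 E F) (p : Polynomial ℝ) :
    U1 ((derivative C * E - C * derivative E) * p) = U0 ((D * E - F * C) * p) := by
  have h1 := h (E * p)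
  have h2 := k (C * p)
  rw [derivative_mul, mul_add, map_add] at h1 h2
  have e1 : C * (E * derivative p) = E * (C * derivative p) := by ring
  have e2 : (derivative C * E - C * derivative E) * p =
    E * (derivative C * p) - C * (derivative E * p) := by ring
  have e3 : (D * E - F * C) * p = D * (E * p) - F * (C * p) := by ring
  rw [e1] at h1
  rw [e2, e3, map_sub, map_sub]
  linarith

/-- If `y U₁ = A U₀` and `∂(C U₁) = D U₀`, then `∂(C A U₁) = (y D + C ∂A) U₁`. -/
theorem pearson (h : DerivRel U0 U1 C D) {y A : Polynomial ℝ}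
    (hA : ∀ p, U1 (y * p) = U0 (A * p)) (p : Polynomial ℝ) :
    -U1 (C * A * derivative p) = U1 ((y * D + C * derivative A) * p) := by
  have h1 := h (A * p)
  have h2 := hA (D * p)
  rw [derivative_mul, mul_add, map_add] at h1
  rw [show D * (A * p) = A * (D * p) by ring] at h1
  rw [show (y * D + C * derivative A) * p = y * (D * p) + C * (derivative A * p) by ring,
    map_add, mul_assoc]
  linarith

end DerivRel

theorem ne_zero_of_orthogonal {U : Polynomial ℝ →ₗ[ℝ] ℝ} (hU : IsQuasiDefinite U)
    {P : ℕ → Polynomial ℝ} (hm : ∀ n, (P n).Monic) (hspan : ⊤ ≤ Submodule.span ℝ (Set.range P))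
    (ho : ∀ m k : ℕ, m ≠ k → U (P m * P k) = 0) (n : ℕ) : U (P n * P n) ≠ 0 := by
  intro h0
  refine (hm n).ne_zero (hU.eq_zero_of_forall_mul fun p => ?_)
  have hp : p ∈ Submodule.span ℝ (Set.range P) := hspan trivial
  induction hp using Submodule.span_induction with
  | mem x hx =>
    obtain ⟨m, rfl⟩ := hx
    by_cases hmn : n = m
    · rw [← hmn, h0]
    · exact ho n m hmn
  | zero => simp
  | add x y _ _ hx hy => rw [mul_add, map_add, hx, hy, add_zero]
  | smul c x _ hx => rw [mul_smul_comm, map_smul, hx, smul_zero]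

theorem span_range_eq_top_of_monic {P : ℕ → Polynomial ℝ} (hm : ∀ n, (P n).Monic)
    (hd : ∀ n, (P n).natDegree = n) : ⊤ ≤ Submodule.span ℝ (Set.range P) := by
  let S : Polynomial.Sequence ℝ :=
    ⟨P, fun n => by rw [degree_eq_natDegree (hm n).ne_zero, hd]⟩
  exact (S.span fun n => by
    change IsUnit (P n).leadingCoeff
    rw [hm n]
    exact isUnit_one).ge

/-- Coherence yields, for every `n`, a relation `∂(C U₁) = D U₀` with `deg C = n + 1` and
`deg D ≤ n + 1`. -/
theorem exists_derivRel
    {U0 U1 : Polynomial ℝ →ₗ[ℝ] ℝ} (hU0 : IsQuasiDefinite U0) (hU1 : IsQuasiDefinite U1)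
    {P0 P1 : ℕ → Polynomial ℝ}
    (hP0monic : ∀ n, (P0 n).Monic) (hP0deg : ∀ n, (P0 n).natDegree = n)
    (hP0orth : ∀ m k : ℕ, m ≠ k → U0 (P0 m * P0 k) = 0)
    (hP1monic : ∀ n, (P1 n).Monic) (hP1deg : ∀ n, (P1 n).natDegree = n)
    (hP1orth : ∀ m k : ℕ, m ≠ k → U1 (P1 m * P1 k) = 0)
    {a : ℕ → ℝ} (ha : ∀ n : ℕ, 1 ≤ n → a n ≠ 0)
    (hcoh : ∀ n : ℕ, 1 ≤ n →
      P1 n = C (((n : ℝ) + 1)⁻¹) * derivative (P0 (n + 1))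
           + C (a n / (n : ℝ)) * derivative (P0 n)) (n : ℕ) :
    ∃ C D : Polynomial ℝ, C.natDegree = n + 1 ∧ D.natDegree ≤ n + 1 ∧ DerivRel U0 U1 C D := by
  have hs0 := span_range_eq_top_of_monic hP0monic hP0deg
  have hs1 := span_range_eq_top_of_monic hP1monic hP1deg
  have hp := ne_zero_of_orthogonal hU0 hP0monic hs0 hP0orth (n + 1)
  set s := U0 (P0 (n + 1) * P0 (n + 1))
  set t : ℕ → ℝ := fun k => U1 (P1 k * P1 k)
  have ht0 : ∀ k, t k ≠ 0 := ne_zero_of_orthogonal hU1 hP1monic hs1 hP1orth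
  set K : Polynomial ℝ := (t n)⁻¹ • P1 n + (a (n + 1) / t (n + 1)) • P1 (n + 1) with hK
  have hKP : ∀ m, U1 (K * P1 m) = if m = n then 1 else if m = n + 1 then a (n + 1) else 0 := by
    intro m
    rw [hK, add_mul, smul_mul_assoc, smul_mul_assoc, map_add, map_smul, map_smul, smul_eq_mul,
      smul_eq_mul]
    by_cases h1 : m = n
    · subst h1
      rw [hP1orth (m + 1) m (by omega), if_pos rfl, mul_zero, add_zero]
      exact inv_mul_cancel₀ (ht0 m)
    · by_cases h2 : m = n + 1
      · subst h2
        rw [hP1orth n (n + 1) (by omega), if_neg h1, if_pos rfl, mul_zero, zero_add]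
        exact div_mul_cancel₀ _ (ht0 (n + 1))
      · rw [hP1orth n m (Ne.symm h1), hP1orth (n + 1) m (Ne.symm h2), if_neg h1, if_neg h2]
        simp
  have hR : ∀ m : ℕ, U1 (K * derivative (P0 (m + 1))) = if m = n then (n : ℝ) + 1 else 0 := by
    intro m
    induction m with
    | zero =>
      have hone : ∀ Q : Polynomial ℝ, Q.Monic → Q.natDegree = 0 → Q = 1 :=
        fun Q h h' => h.natDegree_eq_zero.1 h'
      have hd1 : derivative (P0 (0 + 1)) = P1 0 := by
        rw [hone _ (hP1monic 0) (hP1deg 0),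
          (hP0monic (0 + 1)).eq_X_add_C (hP0deg (0 + 1))]
        simp
      rw [hd1, hKP]
      by_cases h : 0 = n
      · subst h; simp
      · rw [if_neg h, if_neg h, if_neg (by omega)]
    | succ m ih =>
      have hc := congrArg (fun q => U1 (K * q)) (hcoh (m + 1) (by omega))
      simp only [mul_add, ← smul_eq_C_mul, mul_smul_comm, map_add, map_smul, smul_eq_mul] at hc
      rw [hKP, ih] at hc
      have hm1 : ((m : ℝ) + 1) ≠ 0 := by positivity
      have hm2 : ((m : ℝ) + 1 + 1) ≠ 0 := by positivity
      push_cast at hc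
      by_cases h1 : m + 1 = n
      · subst h1
        simp only [if_true, if_neg (show m ≠ m + 1 by omega), mul_zero, add_zero] at hc ⊢
        push_cast
        field_simp at hc
        linarith
      · by_cases h2 : m = n
        · subst h2
          simp only [if_true, if_neg h1, div_mul_cancel₀ _ hm1] at hc ⊢
          have : ((m : ℝ) + 1 + 1)⁻¹ * U1 (K * derivative (P0 (m + 1 + 1))) = 0 := by linarith
          simpa [hm2] using this
        · simp only [if_neg h1, if_neg h2, mul_zero, add_zero] at hc ⊢
          simpa [hm2] using hc.symm
  refine ⟨K, (-((n : ℝ) + 1) / s) • P0 (n + 1), ?_, ?_, fun p => ?_⟩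
  · have hane := div_ne_zero (ha (n + 1) (by omega)) (ht0 (n + 1))
    have hd : ((a (n + 1) / t (n + 1)) • P1 (n + 1)).natDegree = n + 1 := by
      rw [natDegree_smul _ hane, hP1deg]
    rw [hK, natDegree_add_eq_right_of_natDegree_lt, hd]
    rw [hd]
    exact (natDegree_smul_le _ _).trans_lt (by rw [hP1deg]; omega)
  · exact (natDegree_smul_le _ _).trans (hP0deg _).le
  · have hp' : p ∈ Submodule.span ℝ (Set.range P0) := hs0 trivial
    induction hp' using Submodule.span_induction with
    | mem x hx =>
      obtain ⟨m, rfl⟩ := hx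
      rw [smul_mul_assoc, map_smul, smul_eq_mul]
      cases m with
      | zero =>
        rw [(hP0monic 0).natDegree_eq_zero.1 (hP0deg 0)]
        have := hP0orth (n + 1) 0 (by omega)
        rw [(hP0monic 0).natDegree_eq_zero.1 (hP0deg 0)] at this
        rw [mul_one] at this ⊢
        simp [this]
      | succ m =>
        rw [hR]
        by_cases h : m = n
        · subst h
          rw [if_pos rfl]
          exact (div_mul_cancel₀ _ hp).symm
        · rw [if_neg h, hP0orth (n + 1) (m + 1) (by omega)]
          simp
    | zero => simp
    | add x y _ _ hx hy => rw [derivative_add, mul_add, mul_add, map_add, map_add, ← hx, ← hy]; ring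
    | smul c x _ hx =>
      rw [derivative_smul, mul_smul_comm, mul_smul_comm, map_smul, map_smul, ← hx, smul_neg]

theorem eq_sum_taylor (ξ : ℝ) {p : Polynomial ℝ} {n : ℕ} (hp : p.natDegree ≤ n) :
    p = ∑ i ∈ Finset.range (n + 1), (taylor ξ p).coeff i • (X - C ξ) ^ i := by
  conv_lhs => rw [← sum_taylor_eq p ξ]
  rw [Polynomial.sum_over_range' _ (by simp) (n + 1) (by rw [natDegree_taylor]; omega)]
  simp only [smul_eq_C_mul]

theorem taylor_coeff_ne_zero (ξ : ℝ) {p : Polynomial ℝ} {n : ℕ} (hp : p.natDegree = n + 1) :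
    (taylor ξ p).coeff (n + 1) ≠ 0 := by
  rw [← hp, ← natDegree_taylor p ξ, coeff_natDegree, Ne, leadingCoeff_eq_zero]
  intro h
  have := natDegree_taylor p ξ
  rw [h, natDegree_zero] at this
  omega

/-- Relations `∂(C U₁) = D U₀` with `C` of degrees 1, 2, 3 can be normalized to involve the powers
of a single linear polynomial up to additive constants. -/
theorem exists_normalized_derivRel {U0 U1 : Polynomial ℝ →ₗ[ℝ] ℝ}
    (h : ∀ n : ℕ, ∃ C D : Polynomial ℝ,
      C.natDegree = n + 1 ∧ D.natDegree ≤ n + 1 ∧ DerivRel U0 U1 C D) :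
    ∃ (ξ β γ : ℝ) (d e f : Polynomial ℝ), d.natDegree ≤ 1 ∧ e.natDegree ≤ 2 ∧
      DerivRel U0 U1 (X - C ξ) d ∧ DerivRel U0 U1 ((X - C ξ) ^ 2 + C β) e ∧
      DerivRel U0 U1 ((X - C ξ) ^ 3 + C γ) f := by
  obtain ⟨C1, D1, hC1, hD1, h1⟩ := h 0
  obtain ⟨C2, D2, hC2, hD2, h2⟩ := h 1
  obtain ⟨C3, D3, hC3, hD3, h3⟩ := h 2
  obtain ⟨u, hu, v, rfl⟩ := natDegree_eq_one.1 hC1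
  set ξ : ℝ := -v / u with hξ
  set L : Polynomial ℝ := X - C ξ with hL
  have r1 : DerivRel U0 U1 L (u⁻¹ • D1) := by
    have e1 : u⁻¹ • (C u * X + C v) = L := by
      have : -ξ = u⁻¹ * v := by rw [hξ]; field_simp
      rw [hL, sub_eq_add_neg, ← C_neg, this, smul_eq_C_mul, mul_add, ← mul_assoc, ← C_mul,
        ← C_mul, inv_mul_cancel₀ hu, C_1, one_mul]
    exact e1 ▸ h1.smul u⁻¹
  have hd : (u⁻¹ • D1).natDegree ≤ 1 := (natDegree_smul_le _ _).trans hD1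
  set d := u⁻¹ • D1
  set q := fun i => (taylor ξ C2).coeff i
  have hq : q 2 ≠ 0 := taylor_coeff_ne_zero ξ hC2
  have hC2' : C2 = q 0 • 1 + q 1 • L + q 2 • L ^ 2 := by
    simpa only [Finset.sum_range_succ, Finset.sum_range_zero, zero_add, pow_zero, pow_one] using
      eq_sum_taylor ξ hC2.le
  set e := (q 2)⁻¹ • (D2 - q 1 • d)
  have r2 : DerivRel U0 U1 (L ^ 2 + C ((q 2)⁻¹ * q 0)) e := by
    have e2 : (q 2)⁻¹ • (C2 - q 1 • L) = L ^ 2 + C ((q 2)⁻¹ * q 0) := by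
      have hi : (C (q 2)⁻¹ : Polynomial ℝ) * C (q 2) = 1 := by
        rw [← C_mul, inv_mul_cancel₀ hq, C_1]
      rw [hC2', C_mul]
      simp only [smul_eq_C_mul]
      linear_combination L ^ 2 * hi
    exact e2 ▸ (h2.sub (r1.smul (q 1))).smul (q 2)⁻¹
  have he : e.natDegree ≤ 2 := (natDegree_smul_le _ _).trans
    (natDegree_sub_le_of_le hD2 ((natDegree_smul_le _ _).trans (hd.trans one_le_two)) |>.trans
      (by norm_num))
  generalize (q 2)⁻¹ * q 0 = β at r2
  set w := fun i => (taylor ξ C3).coeff i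
  have hw : w 3 ≠ 0 := taylor_coeff_ne_zero ξ hC3
  have hC3' : C3 = w 0 • 1 + w 1 • L + w 2 • L ^ 2 + w 3 • L ^ 3 := by
    simpa only [Finset.sum_range_succ, Finset.sum_range_zero, zero_add, pow_zero, pow_one] using
      eq_sum_taylor ξ hC3.le
  refine ⟨ξ, β, (w 3)⁻¹ * (w 0 - w 2 * β), d, e, (w 3)⁻¹ • (D3 - w 1 • d - w 2 • e), hd, he,
    r1, r2, ?_⟩
  have e3 : (w 3)⁻¹ • (C3 - w 1 • L - w 2 • (L ^ 2 + C β)) =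
      L ^ 3 + C ((w 3)⁻¹ * (w 0 - w 2 * β)) := by
    have hi : (C (w 3)⁻¹ : Polynomial ℝ) * C (w 3) = 1 := by
      rw [← C_mul, inv_mul_cancel₀ hw, C_1]
    rw [hC3', C_mul, C_sub, C_mul]
    simp only [smul_eq_C_mul]
    linear_combination L ^ 3 * hi
  exact e3 ▸ ((h3.sub (r1.smul (w 1))).sub (r2.smul (w 2))).smul (w 3)⁻¹

theorem isClassicalExt_or_of_derivRel {U0 U1 : Polynomial ℝ →ₗ[ℝ] ℝ}
    (hU0 : IsQuasiDefinite U0) (hU1 : IsQuasiDefinite U1)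
    {ξ β γ : ℝ} {d e f : Polynomial ℝ} (hd : d.natDegree ≤ 1) (he : e.natDegree ≤ 2)
    (h1 : DerivRel U0 U1 (X - C ξ) d) (h2 : DerivRel U0 U1 ((X - C ξ) ^ 2 + C β) e)
    (h3 : DerivRel U0 U1 ((X - C ξ) ^ 3 + C γ) f) :
    IsClassicalExt U0 ∨ IsClassicalExt U1 := by
  set L : Polynomial ℝ := X - C ξ with hL
  have hL1 : L.natDegree = 1 := natDegree_X_sub_C ξ
  have hL0 : L ≠ 0 := X_sub_C_ne_zero ξ
  have hdL : derivative L = 1 := derivative_X_sub_C ξ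
  have hQ : (L ^ 2 - C β).natDegree = 2 := by
    rw [natDegree_sub_C, natDegree_pow, hL1]
  have hQ0 : L ^ 2 - C β ≠ 0 := fun h => by rw [h, natDegree_zero] at hQ; omega
  -- `(L² - β) U₁ = A₂ U₀` and `(2L³ - γ) U₁ = A₃ U₀`
  set A2 := L * e - (L ^ 2 + C β) * d with hA2
  set A3 := L * f - (L ^ 3 + C γ) * d with hA3
  have hA2d : A2.natDegree ≤ 3 := by
    refine (natDegree_sub_le_of_le (natDegree_mul_le_of_le hL1.le he)
      (natDegree_mul_le_of_le (m := 2) ?_ hd)).trans (by norm_num)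
    rw [natDegree_add_C, natDegree_pow, hL1]
  have w2 : ∀ p, U1 ((L ^ 2 - C β) * p) = U0 (A2 * p) := fun p => by
    have h := h2.wronskian h1 p
    rw [derivative_add, derivative_pow, hdL, derivative_C] at h
    convert h using 2
    · push_cast
      simp only [map_ofNat]
      ring
    · rw [hA2]; ring
  have w3 : ∀ p, U1 ((2 * L ^ 3 - C γ) * p) = U0 (A3 * p) := fun p => by
    have h := h3.wronskian h1 p
    rw [derivative_add, derivative_pow, hdL, derivative_C] at h
    convert h using 2
    · push_cast
      simp only [map_ofNat]
      ring
    · rw [hA3]; ring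
  -- `(2β L - γ) U₁ = A U₀`
  set y := 2 * C β * L - C γ with hy
  have hyd : y.natDegree ≤ 1 := by
    rw [hy, natDegree_sub_C, mul_assoc, show (2 : Polynomial ℝ) = C 2 from rfl]
    exact (natDegree_C_mul_le _ _).trans ((natDegree_C_mul_le _ _).trans hL1.le)
  set A := A3 - 2 * L * A2 with hA
  have w : ∀ p, U1 (y * p) = U0 (A * p) := fun p => by
    have k1 := w3 p
    have k2 := w2 (2 * L * p)
    rw [show y * p = (2 * L ^ 3 - C γ) * p - (L ^ 2 - C β) * (2 * L * p) by rw [hy]; ring,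
      show A * p = A3 * p - A2 * (2 * L * p) by rw [hA]; ring, map_sub, map_sub, k1, k2]
  have hAy : A * (L ^ 2 - C β) = y * A2 := hU0.eq_of_forall_mul fun p => by
    rw [mul_assoc, ← w, show y * A2 * p = A2 * (y * p) by ring, ← w2]
    congr 1
    ring
  have hA0 : y ≠ 0 → A ≠ 0 := fun hy0 hA0 => hy0 <| hU1.eq_zero_of_forall_mul fun p => by
    rw [w, hA0, zero_mul, map_zero]
  have hAd : A ≠ 0 → A.natDegree + 2 = (y * A2).natDegree := fun h => by
    rw [← hAy, natDegree_mul h hQ0, hQ]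
  by_cases hβ : β = 0
  · by_cases hγ : γ = 0
    · left
      have k : ∀ p, U1 (L * p) = U0 ((e - L * d) * p) := fun p => by
        have k1 := h1 (L * p)
        have k2 := h2 p
        rw [derivative_mul, hdL, one_mul, mul_add, map_add] at k1
        rw [hβ, C_0, add_zero] at k2
        rw [show (e - L * d) * p = e * p - d * (L * p) by ring, map_sub, ← k1, ← k2,
          show L ^ 2 * derivative p = L * (L * derivative p) by ring]
        ring
      refine hU0.isClassicalExt (φ := e - L * d) (ψ := d) (fun h0 => hL0 ?_) ?_ hd fun p => ?_
      · exact hU1.eq_zero_of_forall_mul fun p => by rw [k, h0, zero_mul, map_zero]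
      · exact (natDegree_sub_le_of_le he (natDegree_mul_le_of_le hL1.le hd)).trans (by norm_num)
      · rw [← k, h1]
    · right
      have hyC : y = C (-γ) := by rw [hy, hβ]; simp
      have hA0 : A ≠ 0 := hA0 (by rw [hyC]; simpa using hγ)
      have hAd1 : A.natDegree ≤ 1 := by
        have k1 := hAd hA0
        have k2 := natDegree_C_mul_le (-γ) A2
        rw [← hyC] at k2
        omega
      refine hU1.isClassicalExt (mul_ne_zero hL0 hA0) ?_ ?_ (h1.pearson w)
      · exact natDegree_mul_le_of_le hL1.le hAd1
      · refine natDegree_add_le_of_degree_le ?_ ?_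
        · rw [hyC]
          exact (natDegree_C_mul_le _ _).trans hd
        · exact natDegree_mul_le_of_le (n := 0) hL1.le
            ((natDegree_derivative_le A).trans (by omega))
  · right
    have hA0 : A ≠ 0 := hA0 fun h0 => by
      have k : y.coeff 1 = 2 * β := by
        rw [hy, hL]
        simp [mul_assoc, show (2 : Polynomial ℝ) = C 2 from rfl]
      rw [h0] at k
      exact hβ (by simpa using k)
    have hAd2 : A.natDegree ≤ 2 := by
      have k1 := hAd hA0
      have k2 := natDegree_mul_le_of_le hyd hA2d
      omega
    have hCβ : (C β : Polynomial ℝ) ≠ 0 := C_ne_zero.2 hβ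
    set ψ := y * e + C β * derivative A - L * (y * d + A) with hψ
    have hpearson : ∀ p, -U1 (C β * A * derivative p) = U1 (ψ * p) := fun p => by
      have k1 := h1.pearson w (L * p)
      have k2 := h2.pearson w p
      rw [derivative_mul, hdL, one_mul, mul_add, map_add] at k1
      rw [show C β * A * derivative p =
        (L ^ 2 + C β) * A * derivative p - L * A * (L * derivative p) by ring,
        show ψ * p = (y * e + (L ^ 2 + C β) * derivative A) * p -
          (y * d + L * derivative A) * (L * p) - L * A * p by rw [hψ]; ring,
        map_sub, map_sub, map_sub, ← k1, ← k2]
      ring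
    have hψL : ψ * L = C β * (y * d + L * derivative A - A) := hU1.eq_of_forall_mul fun p => by
      have k1 := hpearson (L * p)
      have k2 := h1.pearson w (C β * p)
      rw [derivative_mul, hdL, one_mul, mul_add, map_add] at k1
      rw [derivative_C_mul] at k2
      rw [mul_assoc, ← k1,
        show C β * (y * d + L * derivative A - A) * p =
          (y * d + L * derivative A) * (C β * p) - C β * A * p by ring, map_sub, ← k2,
        show L * A * (C β * derivative p) = C β * A * (L * derivative p) by ring]
      ring
    have hdA : (L * derivative A).natDegree ≤ 2 :=
      natDegree_mul_le_of_le (n := 1) hL1.le ((natDegree_derivative_le A).trans (by omega))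
    have hψd : ψ.natDegree ≤ 1 := by
      by_cases hψ0 : ψ = 0
      · simp [hψ0]
      · have k1 := natDegree_mul hψ0 hL0
        rw [hψL, hL1] at k1
        have k2 : (C β * (y * d + L * derivative A - A)).natDegree ≤ 2 :=
          (natDegree_C_mul_le _ _).trans <| (natDegree_sub_le_of_le
            (natDegree_add_le_of_degree_le (natDegree_mul_le_of_le hyd hd) hdA) hAd2).trans
              (by norm_num)
        omega
    exact hU1.isClassicalExt (mul_ne_zero hCβ hA0) ((natDegree_C_mul_le _ _).trans hAd2) hψd
      hpearson

/-- If {U₀, U₁} is a coherent pair of quasi-definite linear functionals, then at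
least one of U₀ and U₁ is classical in the extended sense. -/
theorem coherent_pair_classical
    (U0 U1 : Polynomial ℝ →ₗ[ℝ] ℝ)
    (hU0 : IsQuasiDefinite U0) (hU1 : IsQuasiDefinite U1)
    -- the monic orthogonal polynomial sequences of U0 and U1
    (P0 P1 : ℕ → Polynomial ℝ)
    (hP0monic : ∀ n, (P0 n).Monic) (hP0deg : ∀ n, (P0 n).natDegree = n)
    (hP0orth : ∀ m k : ℕ, m ≠ k → U0 (P0 m * P0 k) = 0)
    (hP1monic : ∀ n, (P1 n).Monic) (hP1deg : ∀ n, (P1 n).natDegree = n)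
    (hP1orth : ∀ m k : ℕ, m ≠ k → U1 (P1 m * P1 k) = 0)
    -- coherence
    (a : ℕ → ℝ) (ha : ∀ n : ℕ, 1 ≤ n → a n ≠ 0)
    (hcoh : ∀ n : ℕ, 1 ≤ n →
      P1 n = Polynomial.C (((n : ℝ) + 1)⁻¹) * derivative (P0 (n + 1))
           + Polynomial.C (a n / (n : ℝ)) * derivative (P0 n)) :
    IsClassicalExt U0 ∨ IsClassicalExt U1 := by
  obtain ⟨ξ, β, γ, d, e, f, hd, he, h1, h2, h3⟩ := exists_normalized_derivRel
    (exists_derivRel hU0 hU1 hP0monic hP0deg hP0orth hP1monic hP1deg hP1orth ha hcoh)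
  exact isClassicalExt_or_of_derivRel hU0 hU1 hd he h1 h2 h3
end

section
/- If {U_0, U_1} is a generalized coherent pair of quasi-definite linear functionals, then at least one of U_0, U_1 is semiclassical of class at most 1. -/
open Polynomial

/-- U is semiclassical of class at most c: there exist polynomials φ ≠ 0 and ψ with deg ψ ≥ 1
such that ∂(φU) = ψU (i.e. −U(φ p') = U(ψ p) for all p) and
max{deg φ − 2, deg ψ − 1} ≤ c. -/
def IsSemiclassicalOfClassLE (U : Polynomial ℝ →ₗ[ℝ] ℝ) (c : ℕ) : Prop :=
  ∃ φ ψ : Polynomial ℝ, φ ≠ 0 ∧ 1 ≤ ψ.natDegree ∧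
    (∀ p : Polynomial ℝ, -U (φ * Polynomial.derivative p) = U (ψ * p)) ∧
    max (φ.natDegree - 2) (ψ.natDegree - 1) ≤ c

/-- Multiplication of functionals by polynomials, `(f • U) p = U (f * p)`. -/
noncomputable instance functionalModule : Module ℝ[X] (ℝ[X] →ₗ[ℝ] ℝ) where
  smul f U := U ∘ₗ LinearMap.mulLeft ℝ f
  one_smul U := LinearMap.ext fun p => congrArg U (one_mul p)
  mul_smul f g U := LinearMap.ext fun p => congrArg U (by simp; ring)
  smul_zero _ := rfl
  smul_add _ _ _ := rfl
  add_smul f g U := LinearMap.ext fun p => (congrArg U (add_mul f g p)).trans (map_add U _ _)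
  zero_smul U := LinearMap.ext fun p => (congrArg U (zero_mul p)).trans (map_zero U)

theorem functional_smul_apply (f : ℝ[X]) (U : ℝ[X] →ₗ[ℝ] ℝ) (p : ℝ[X]) :
    (f • U) p = U (f * p) := rfl

/-- The distributional derivative of a functional, `p ↦ -U p'`. -/
noncomputable def functionalDeriv (U : ℝ[X] →ₗ[ℝ] ℝ) : ℝ[X] →ₗ[ℝ] ℝ :=
  -(U ∘ₗ derivative)

theorem functionalDeriv_apply (U : ℝ[X] →ₗ[ℝ] ℝ) (p : ℝ[X]) :
    functionalDeriv U p = -U (derivative p) := rfl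

theorem functionalDeriv_smul (f : ℝ[X]) (U : ℝ[X] →ₗ[ℝ] ℝ) :
    functionalDeriv (f • U) = derivative f • U + f • functionalDeriv U := by
  refine LinearMap.ext fun p => ?_
  rw [LinearMap.add_apply, functionalDeriv_apply, functional_smul_apply, functional_smul_apply,
    functional_smul_apply, functionalDeriv_apply, derivative_mul, map_add]
  ring

/-- A quasi-definite functional is annihilated by no nonzero polynomial. -/
theorem IsQuasiDefinite.eq_zero_of_smul {U : ℝ[X] →ₗ[ℝ] ℝ} (hU : IsQuasiDefinite U)
    {f : ℝ[X]} (hf : f • U = 0) : f = 0 := by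
  have hv := Matrix.eq_zero_of_mulVec_eq_zero (hU f.natDegree)
    (v := fun j : Fin (f.natDegree + 1) => f.coeff j) <| by
      funext i
      obtain ⟨k, hk⟩ := i
      have h : U (f * X ^ k) = 0 := by
        rw [← functional_smul_apply, hf, LinearMap.zero_apply]
      rw [f.as_sum_range, Finset.sum_mul, map_sum, Finset.sum_range] at h
      rw [Pi.zero_apply, ← h, Matrix.mulVec, dotProduct]
      refine Finset.sum_congr rfl fun j _ => ?_
      rw [← C_mul_X_pow_eq_monomial, mul_assoc, ← pow_add, ← smul_eq_C_mul, map_smul,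
        Matrix.of_apply, smul_eq_mul, mul_comm, add_comm k]
  by_contra h0
  exact h0 (leadingCoeff_eq_zero.mp (congrFun hv (Fin.last f.natDegree)))

theorem IsQuasiDefinite.smul_injective {U : ℝ[X] →ₗ[ℝ] ℝ} (hU : IsQuasiDefinite U)
    {f g : ℝ[X]} (h : f • U = g • U) : f = g :=
  sub_eq_zero.mp <| hU.eq_zero_of_smul (by rw [sub_smul, h, sub_self])

theorem isSemiclassicalOfClassLE_one_of_functionalDeriv {U : ℝ[X] →ₗ[ℝ] ℝ}
    (hU : IsQuasiDefinite U) {φ ψ : ℝ[X]} (hφ0 : φ ≠ 0) (hφ : φ.natDegree ≤ 3)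
    (hψ : ψ.natDegree ≤ 2) (h : functionalDeriv (φ • U) = ψ • U) :
    IsSemiclassicalOfClassLE U 1 := by
  have hp (p : ℝ[X]) : -U (φ * derivative p) = U (ψ * p) := LinearMap.congr_fun h p
  refine ⟨φ, ψ, hφ0, ?_, hp, by omega⟩
  by_contra hlt
  obtain ⟨c, rfl⟩ := natDegree_eq_zero.mp (by omega : ψ.natDegree = 0)
  have hU1 : U 1 ≠ 0 := by simpa using hU 0
  have hc : c = 0 := by
    have h1 := hp 1
    rw [derivative_one, mul_zero, map_zero, neg_zero, ← smul_eq_C_mul, map_smul, smul_eq_mul] at h1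
    exact (mul_eq_zero.mp h1.symm).resolve_right hU1
  subst hc
  refine hφ0 (hU.eq_zero_of_smul ?_)
  refine (basisMonomials ℝ).ext fun n => ?_
  have hX := hp (C ((n + 1 : ℝ)⁻¹) * X ^ (n + 1))
  have hd : derivative (C ((n + 1 : ℝ)⁻¹) * X ^ (n + 1)) = monomial n 1 := by
    rw [derivative_C_mul_X_pow, ← C_mul_X_pow_eq_monomial]
    have : (n : ℝ) + 1 ≠ 0 := by positivity
    push_cast
    rw [inv_mul_cancel₀ this]
  rw [hd] at hX
  simpa [functional_smul_apply] using hX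

/-- Monic polynomials with `deg (P n) = n`, as a polynomial sequence. -/
noncomputable def monicSequence {P : ℕ → ℝ[X]} (hmonic : ∀ n, (P n).Monic)
    (hdeg : ∀ n, (P n).natDegree = n) : Sequence ℝ where
  elems' := P
  degree_eq' i := by rw [degree_eq_natDegree (hmonic i).ne_zero, hdeg]

theorem isUnit_leadingCoeff_monicSequence {P : ℕ → ℝ[X]} (hmonic : ∀ n, (P n).Monic)
    (hdeg : ∀ n, (P n).natDegree = n) (n : ℕ) :
    IsUnit (monicSequence hmonic hdeg n).leadingCoeff :=
  isUnit_iff_ne_zero.mpr ((hmonic n).leadingCoeff.trans_ne one_ne_zero)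

theorem functional_ext {P : ℕ → ℝ[X]} (hmonic : ∀ n, (P n).Monic)
    (hdeg : ∀ n, (P n).natDegree = n) {L M : ℝ[X] →ₗ[ℝ] ℝ} (h : ∀ n, L (P n) = M (P n)) :
    L = M :=
  ((monicSequence hmonic hdeg).basis (isUnit_leadingCoeff_monicSequence hmonic hdeg)).ext
    fun n => by rw [Sequence.basis_eq_self]; exact h n

theorem apply_mul_eq_zero_of_degree_lt {U : ℝ[X] →ₗ[ℝ] ℝ} {P : ℕ → ℝ[X]}
    (hmonic : ∀ n, (P n).Monic) (hdeg : ∀ n, (P n).natDegree = n)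
    (horth : ∀ m k : ℕ, m ≠ k → U (P m * P k) = 0) {f : ℝ[X]} {m : ℕ}
    (hf : f.degree < m) : U (f * P m) = 0 := by
  have hspan : f ∈ Submodule.span ℝ (monicSequence hmonic hdeg '' Set.Iio m) := by
    rw [Sequence.span_degreeLT _ fun i _ => isUnit_leadingCoeff_monicSequence hmonic hdeg i]
    exact mem_degreeLT.mpr hf
  refine Submodule.span_le (p := LinearMap.ker (U ∘ₗ LinearMap.mulRight ℝ (P m))).mpr ?_ hspan
  rintro _ ⟨i, hi, rfl⟩
  exact horth i m (ne_of_lt hi)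

theorem apply_mul_self_ne_zero {U : ℝ[X] →ₗ[ℝ] ℝ} (hU : IsQuasiDefinite U) {P : ℕ → ℝ[X]}
    (hmonic : ∀ n, (P n).Monic) (hdeg : ∀ n, (P n).natDegree = n)
    (horth : ∀ m k : ℕ, m ≠ k → U (P m * P k) = 0) (m : ℕ) : U (P m * P m) ≠ 0 := fun h0 => by
  refine (hmonic m).ne_zero (hU.eq_zero_of_smul (functional_ext hmonic hdeg fun k => ?_))
  obtain rfl | hk := eq_or_ne m k
  · exact h0
  · exact horth m k hk

/-- A functional vanishing on all orthogonal polynomials of degree greater than `n` is a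
polynomial multiple of `U`. -/
theorem exists_eq_smul_of_forall_gt {U : ℝ[X] →ₗ[ℝ] ℝ} (hU : IsQuasiDefinite U) {P : ℕ → ℝ[X]}
    (hmonic : ∀ n, (P n).Monic) (hdeg : ∀ n, (P n).natDegree = n)
    (horth : ∀ m k : ℕ, m ≠ k → U (P m * P k) = 0) {L : ℝ[X] →ₗ[ℝ] ℝ} {n : ℕ}
    (hL : ∀ m, n < m → L (P m) = 0) : ∃ χ : ℝ[X], χ.natDegree ≤ n ∧ L = χ • U := by
  refine ⟨∑ m ∈ Finset.range (n + 1), C (L (P m) / U (P m * P m)) * P m, ?_,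
    functional_ext hmonic hdeg fun k => ?_⟩
  · refine natDegree_sum_le_of_forall_le _ _ fun m hm => (natDegree_C_mul_le _ _).trans ?_
    rw [hdeg]
    exact Nat.lt_succ_iff.mp (Finset.mem_range.mp hm)
  · rw [functional_smul_apply, Finset.sum_mul, map_sum, Finset.sum_eq_single k]
    · rw [mul_assoc, ← smul_eq_C_mul, map_smul, smul_eq_mul,
        div_mul_cancel₀ _ (apply_mul_self_ne_zero hU hmonic hdeg horth k)]
    · intro m _ hm
      rw [mul_assoc, ← smul_eq_C_mul, map_smul, horth m k hm, smul_zero]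
    · intro hk
      rw [hL k (by simpa using hk), zero_div, C_0, zero_mul, zero_mul, map_zero]

/-- For a coherent pair, the polynomials `f` with `deg f ≤ 3` for which `∂(f U₁)` is a polynomial
multiple of `U₀` are cut out by one linear condition. -/
theorem exists_functionalDeriv_smul_eq
    {U0 U1 : ℝ[X] →ₗ[ℝ] ℝ} (hU0 : IsQuasiDefinite U0) {P0 P1 : ℕ → ℝ[X]}
    (hP0monic : ∀ n, (P0 n).Monic) (hP0deg : ∀ n, (P0 n).natDegree = n)
    (hP0orth : ∀ m k : ℕ, m ≠ k → U0 (P0 m * P0 k) = 0)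
    (hP1monic : ∀ n, (P1 n).Monic) (hP1deg : ∀ n, (P1 n).natDegree = n)
    (hP1orth : ∀ m k : ℕ, m ≠ k → U1 (P1 m * P1 k) = 0)
    {a b : ℕ → ℝ} (ha : ∀ n : ℕ, 1 ≤ n → a n ≠ 0)
    (hcoh : ∀ n : ℕ, 1 ≤ n →
      P1 n + C (b (n - 1)) * P1 (n - 1)
        = C (((n : ℝ) + 1)⁻¹) * derivative (P0 (n + 1))
          + C (a n / (n : ℝ)) * derivative (P0 n))
    {f : ℝ[X]} {n : ℕ} (hn : n ≤ 3) (hf : f.natDegree ≤ n)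
    (hτ : U1 (f * derivative (P0 5)) = 0) :
    ∃ χ : ℝ[X], χ.natDegree ≤ n + 1 ∧ functionalDeriv (f • U1) = χ • U0 := by
  have hstep (m : ℕ) (hm : n + 2 ≤ m) :
      U1 (f * derivative (P0 (m + 1))) = 0 ↔ U1 (f * derivative (P0 m)) = 0 := by
    have hlt (j : ℕ) (hj : n + 1 ≤ j) : U1 (f * P1 j) = 0 :=
      apply_mul_eq_zero_of_degree_lt hP1monic hP1deg hP1orth <|
        degree_le_natDegree.trans_lt (by exact_mod_cast (by omega : f.natDegree < j))
    have h := congrArg (fun p => U1 (f * p)) (hcoh m (by omega))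
    simp only [mul_add, map_add, ← smul_eq_C_mul, mul_smul_comm, map_smul,
      smul_eq_mul, hlt m (by omega), hlt (m - 1) (by omega), mul_zero, add_zero] at h
    have hm0 : (m : ℝ) ≠ 0 := by exact_mod_cast (by omega : m ≠ 0)
    have hm1 : (m : ℝ) + 1 ≠ 0 := by positivity
    have ham := ha m (by omega)
    constructor <;> intro h' <;> rw [h'] at h <;> simpa [hm0, hm1, ham] using h
  have hall (m : ℕ) (hm : n + 2 ≤ m) :
      U1 (f * derivative (P0 m)) = 0 ↔ U1 (f * derivative (P0 (n + 2))) = 0 := by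
    induction m, hm using Nat.le_induction with
    | base => rfl
    | succ m hm ih => exact (hstep m hm).trans ih
  refine exists_eq_smul_of_forall_gt hU0 hP0monic hP0deg hP0orth fun m hm => ?_
  rw [functionalDeriv_apply, functional_smul_apply,
    (hall m hm).mpr ((hall 5 (by omega)).mp hτ), neg_zero]

/-- If `τ` is a linear form such that `∂(f V)` is a polynomial multiple of `U` for every `f` with
`τ f = 0` and `deg f ≤ 3`, with control on degrees, then `U` or `V` is semiclassical. -/
theorem isSemiclassicalOfClassLE_one_or {U V : ℝ[X] →ₗ[ℝ] ℝ} (hU : IsQuasiDefinite U)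
    (hV : IsQuasiDefinite V) (τ : ℝ[X] →ₗ[ℝ] ℝ)
    (hτ : ∀ (f : ℝ[X]) (n : ℕ), n ≤ 3 → f.natDegree ≤ n → τ f = 0 →
      ∃ χ : ℝ[X], χ.natDegree ≤ n + 1 ∧ functionalDeriv (f • V) = χ • U) :
    IsSemiclassicalOfClassLE U 1 ∨ IsSemiclassicalOfClassLE V 1 := by
  have hV0 : V ≠ 0 := by
    rintro rfl
    simpa using hV 0
  simp only [functionalDeriv_smul] at hτ
  set D := functionalDeriv V with hD
  by_cases h1 : τ 1 = 0
  · obtain ⟨χ₀, hχ₀, e₀⟩ := hτ 1 0 (by omega) (by simp) h1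
    rw [derivative_one, zero_smul, zero_add, one_smul] at e₀
    by_cases hX : τ (X : ℝ[X]) = 0
    · obtain ⟨χ₁, hχ₁, e₁⟩ := hτ X 1 (by omega) natDegree_X_le hX
      rw [derivative_X, one_smul] at e₁
      have hVM : V = (χ₁ - X * χ₀) • U := by
        linear_combination (norm := module) e₁ - (X : ℝ[X]) • e₀
      refine .inl (isSemiclassicalOfClassLE_one_of_functionalDeriv hU (φ := χ₁ - X * χ₀) (ψ := χ₀)
        ?_ ?_ (by omega) (by rw [← hVM, ← hD, e₀]))
      · intro h
        exact hV0 (by rw [hVM, h, zero_smul])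
      · compute_degree
        omega
    · obtain ⟨c, hc⟩ : ∃ c : ℝ, τ (X ^ 2) = c * τ X := ⟨τ (X ^ 2) / τ X, by field_simp⟩
      obtain ⟨χ₁, hχ₁, e₁⟩ := hτ (X ^ 2 - C c * X) 2 (by omega) (by compute_degree)
        (by rw [map_sub, ← smul_eq_C_mul, map_smul, smul_eq_mul, hc, sub_self])
      have hd : derivative (X ^ 2 - C c * X) = C 2 * X - C c := by
        rw [derivative_sub, derivative_X_sq, derivative_C_mul, derivative_X, mul_one]
      rw [hd] at e₁
      have hVM : (C 2 * X - C c) • V = (χ₁ - (X ^ 2 - C c * X) * χ₀) • U := by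
        linear_combination (norm := module) e₁ - (X ^ 2 - C c * X : ℝ[X]) • e₀
      set M := χ₁ - (X ^ 2 - C c * X) * χ₀ with hM
      have hMdeg : M.natDegree ≤ 3 := by
        rw [hM]
        compute_degree
        omega
      have hMder : (derivative M).natDegree ≤ 2 := (natDegree_derivative_le M).trans (by omega)
      refine .inr (isSemiclassicalOfClassLE_one_of_functionalDeriv hV (φ := M)
        (ψ := derivative M + χ₀ * (C 2 * X - C c)) ?_ hMdeg ?_ ?_)
      · intro h
        have := hV.eq_zero_of_smul (hVM.trans (by rw [h, zero_smul]))
        simpa using congrArg (coeff · 1) this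
      · compute_degree
        omega
      · rw [functionalDeriv_smul]
        linear_combination (norm := module) M • e₀ - χ₀ • hVM
  · obtain ⟨y, hyτ, hydeg, hyder⟩ : ∃ y : ℝ[X], τ y = 0 ∧ y.natDegree ≤ 1 ∧ derivative y = 1 := by
      refine ⟨X - C (τ X / τ 1), ?_, by compute_degree, by simp⟩
      rw [← mul_one (C _), ← smul_eq_C_mul, map_sub, map_smul, smul_eq_mul, div_mul_cancel₀ _ h1,
        sub_self]
    have hy0 : y ≠ 0 := by
      rintro rfl
      simp at hyder
    have hsub (p : ℝ[X]) : ∃ v : ℝ, τ (p - C v) = 0 := by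
      refine ⟨τ p / τ 1, ?_⟩
      rw [← mul_one (C _), ← smul_eq_C_mul, map_sub, map_smul, smul_eq_mul, div_mul_cancel₀ _ h1,
        sub_self]
    obtain ⟨v, hv⟩ := hsub (y ^ 2)
    obtain ⟨z, hz⟩ := hsub (y ^ 3)
    obtain ⟨χ₀, hχ₀, e₀⟩ := hτ y 1 (by omega) hydeg hyτ
    obtain ⟨χ₁, hχ₁, e₁⟩ := hτ _ 2 (by omega) (by compute_degree; omega) hv
    obtain ⟨χ₂, hχ₂, e₂⟩ := hτ _ 3 (by omega) (by compute_degree; omega) hz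
    rw [hyder, one_smul] at e₀
    have hd₁ : derivative (y ^ 2 - C v) = C 2 * y := by simp [derivative_pow, hyder]
    have hd₂ : derivative (y ^ 3 - C z) = C 3 * y ^ 2 := by simp [derivative_pow, hyder]
    rw [hd₁] at e₁
    rw [hd₂] at e₂
    have hC2 : (C 2 : ℝ[X]) = 2 := rfl
    have hC3 : (C 3 : ℝ[X]) = 3 := rfl
    rw [hC2] at e₁
    rw [hC3] at e₂
    by_cases hv0 : v = 0
    · subst hv0
      rw [C_0, sub_zero] at e₁
      have hVM : y • V = (χ₁ - y * χ₀) • U := by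
        linear_combination (norm := module) e₁ - y • e₀
      refine .inl (isSemiclassicalOfClassLE_one_of_functionalDeriv hU (φ := χ₁ - y * χ₀) (ψ := χ₀)
        ?_ ?_ hχ₀ ?_)
      · intro h
        exact hy0 (hV.eq_zero_of_smul (hVM.trans (by rw [h, zero_smul])))
      · compute_degree
        omega
      · rw [← hVM, functionalDeriv_smul, hyder, one_smul, ← hD, e₀]
    set N := 2 * y * χ₀ - χ₁ with hN
    set S := χ₂ - 2 * y * χ₁ + y ^ 2 * χ₀ with hS
    have hNdeg : N.natDegree ≤ 3 := by
      rw [hN]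
      compute_degree
      omega
    have hy1 : y.natDegree = 1 := by
      refine le_antisymm hydeg (Nat.one_le_iff_ne_zero.mpr fun h => ?_)
      obtain ⟨c, rfl⟩ := natDegree_eq_zero.mp h
      simp at hyder
    have hWN : (y ^ 2 + C v) • D = N • U := by
      linear_combination (norm := module) (2 * y) • e₀ - e₁
    have hyS : (2 * C v * y - C z) • D = S • U := by
      linear_combination (norm := module) e₂ - (2 * y) • e₁ + y ^ 2 • e₀
    by_cases hk : z ^ 2 + 4 * v ^ 3 = 0
    · obtain ⟨α, rfl⟩ : ∃ α, z = 2 * v * α := ⟨z / (2 * v), by field_simp⟩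
      have hα : v = -α ^ 2 := by
        have : 4 * v ^ 2 * (v + α ^ 2) = 0 := by linear_combination hk
        have := (mul_eq_zero.mp this).resolve_left (by positivity)
        linarith
      have hα0 : α ≠ 0 := by
        rintro rfl
        simp [hα] at hv0
      have hCv : (C v : ℝ[X]) = -C α ^ 2 := by rw [hα, C_neg, C_pow]
      obtain ⟨N₁, hN₁⟩ : ∃ N₁ : ℝ[X], (y - C α) • D = N₁ • U := by
        refine ⟨C (1 / (2 * v)) * S, ?_⟩
        have hinv : C (1 / (2 * v)) * (2 * C v) = (1 : ℝ[X]) := by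
          rw [← hC2, ← C_mul, ← C_mul, one_div_mul_cancel (by positivity), C_1]
        rw [mul_smul, ← hyS, smul_smul]
        congr 1
        rw [C_mul, C_mul, hC2]
        linear_combination -(y - C α) * hinv
      have hN₁N : (y + C α) * N₁ = N := hU.smul_injective <| by
        rw [hCv] at hWN
        linear_combination (norm := module) hWN - (y + C α) • hN₁
      have hyα (c : ℝ) : (y + C c).natDegree = 1 := by rw [natDegree_add_C, hy1]
      have hyα0 (c : ℝ) : y + C c ≠ 0 := by
        intro h
        simpa [h] using hyα c
      have hN₁deg : N₁.natDegree ≤ 2 := by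
        by_cases h0 : N₁ = 0
        · simp [h0]
        · have := congrArg natDegree hN₁N
          rw [natDegree_mul (hyα0 α) h0, hyα] at this
          omega
      set M := (y - C α) * χ₀ - y * N₁ with hM
      have hMdeg : M.natDegree ≤ 3 := by
        rw [hM]
        compute_degree
        omega
      have hMder : (derivative M).natDegree ≤ 2 := (natDegree_derivative_le M).trans (by omega)
      have hVM : (y - C α) • V = M • U := by
        linear_combination (norm := module) (y - C α) • e₀ - y • hN₁
      have hαMD : C α • (M • D - N₁ • V) = 0 := by
        linear_combination (norm := module) M • e₀ - χ₀ • hVM - M • hN₁ + N₁ • hVM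
      have hMD : M • D = N₁ • V := by
        have := congrArg ((C α⁻¹ : ℝ[X]) • ·) hαMD
        simp only [smul_smul, smul_zero] at this
        rw [← C_mul, inv_mul_cancel₀ hα0, C_1, one_smul] at this
        exact sub_eq_zero.mp this
      refine .inr (isSemiclassicalOfClassLE_one_of_functionalDeriv hV (φ := M)
        (ψ := derivative M + N₁) ?_ hMdeg ?_ ?_)
      · intro h
        refine hyα0 (-α) (hV.eq_zero_of_smul ?_)
        rw [C_neg, ← sub_eq_add_neg, hVM, h, zero_smul]
      · compute_degree
        omega
      · rw [functionalDeriv_smul, ← hD, hMD, add_smul]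
    · obtain ⟨N₂, hN₂⟩ : ∃ N₂ : ℝ[X], D = N₂ • U := by
        refine ⟨C (z ^ 2 + 4 * v ^ 3)⁻¹ * (4 * C v ^ 2 * N - (2 * C v * y + C z) * S), ?_⟩
        have hkD : C (z ^ 2 + 4 * v ^ 3) • D
            = (4 * C v ^ 2 * N - (2 * C v * y + C z) * S) • U := by
          have hC4 : (C 4 : ℝ[X]) = 4 := rfl
          rw [C_add, C_mul, C_pow, C_pow, hC4]
          linear_combination (norm := module) (4 * C v ^ 2) • hWN - (2 * C v * y + C z) • hyS
        rw [mul_smul, ← hkD, smul_smul, ← C_mul, inv_mul_cancel₀ hk, C_1, one_smul]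
      have hWN₂ : (y ^ 2 + C v) * N₂ = N := hU.smul_injective <| by
        linear_combination (norm := module) hWN - (y ^ 2 + C v) • hN₂
      have hWdeg : (y ^ 2 + C v).natDegree = 2 := by
        rw [natDegree_add_C, natDegree_pow, hy1]
      have hN₂deg : N₂.natDegree ≤ 1 := by
        by_cases h0 : N₂ = 0
        · simp [h0]
        · have := congrArg natDegree hWN₂
          rw [natDegree_mul (fun h => by simp [h] at hWdeg) h0, hWdeg] at this
          omega
      have hVM : V = (χ₀ - y * N₂) • U := by
        linear_combination (norm := module) e₀ - y • hN₂
      refine .inl (isSemiclassicalOfClassLE_one_of_functionalDeriv hU (φ := χ₀ - y * N₂) (ψ := N₂)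
        ?_ ?_ (by omega) (by rw [← hVM, ← hD, hN₂]))
      · intro h
        exact hV0 (by rw [hVM, h, zero_smul])
      · compute_degree
        omega

/-- If {U₀, U₁} is a generalized coherent pair of quasi-definite linear
functionals, then at least one of U₀, U₁ is semiclassical of class at most 1. -/
theorem generalized_coherent_pair_semiclassical
    (U0 U1 : Polynomial ℝ →ₗ[ℝ] ℝ)
    (hU0 : IsQuasiDefinite U0) (hU1 : IsQuasiDefinite U1)
    (P0 P1 : ℕ → Polynomial ℝ)
    (hP0monic : ∀ n, (P0 n).Monic) (hP0deg : ∀ n, (P0 n).natDegree = n)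
    (hP0orth : ∀ m k : ℕ, m ≠ k → U0 (P0 m * P0 k) = 0)
    (hP1monic : ∀ n, (P1 n).Monic) (hP1deg : ∀ n, (P1 n).natDegree = n)
    (hP1orth : ∀ m k : ℕ, m ≠ k → U1 (P1 m * P1 k) = 0)
    -- generalized coherence
    (a b : ℕ → ℝ) (ha : ∀ n : ℕ, 1 ≤ n → a n ≠ 0)
    (hcoh : ∀ n : ℕ, 1 ≤ n →
      P1 n + Polynomial.C (b (n - 1)) * P1 (n - 1)
        = Polynomial.C (((n : ℝ) + 1)⁻¹) * derivative (P0 (n + 1))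
          + Polynomial.C (a n / (n : ℝ)) * derivative (P0 n)) :
    IsSemiclassicalOfClassLE U0 1 ∨ IsSemiclassicalOfClassLE U1 1 := by
  exact isSemiclassicalOfClassLE_one_or hU0 hU1
    (U1 ∘ₗ LinearMap.mulRight ℝ (derivative (P0 5))) fun _ _ hn hf hτ =>
      exists_functionalDeriv_smul_eq hU0 hP0monic hP0deg hP0orth hP1monic hP1deg hP1orth ha hcoh
        hn hf hτ
end
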